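/- For all integers k ≥ 3 and 1 ≤ ℓ < k/2 there exist ε, θ, ξ > 0 and n₀ such that the following holds. Let n ≥ n₀ be divisible by k−ℓ, let H = (V,E) be an (ℓ,ξ)-extremal k-uniform hypergraph on n vertices with δ_{k−2}(H) > δ_{k−2}(X_{k,ℓ}(n)), let V = A ∪ B be a minimal extremal partition, define A_ε, B_ε as above, and suppose q = |A ∩ B_ε| > 0. Then there exist 2q + 2 vertex-disjoint ℓ-paths of size three (i.e., with exactly three edges each) in H, each of which contains exactly one vertex from A_ε and has two ε-typical ℓ-sets as its ends. -/

import Mathlib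

open Finset

/-- `E` is the edge set of a `k`-uniform hypergraph on vertex set `Fin n`:
every edge is a `k`-element set of vertices. -/
def Uniform (n k : ℕ) (E : Finset (Finset (Fin n))) : Prop :=
  ∀ e ∈ E, e.card = k

/-- The degree `d(S)` of a vertex set `S`: the number of edges containing `S`. -/
def deg {n : ℕ} (E : Finset (Finset (Fin n))) (S : Finset (Fin n)) : ℕ :=
  (E.filter fun e => S ⊆ e).card

/-- The minimum `s`-degree `δ_s(H)`: the minimum of `d(S)` over all `s`-element
vertex sets `S`. -/
noncomputable def minDeg (n : ℕ) (E : Finset (Finset (Fin n))) (s : ℕ) : ℕ :=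
  sInf {d | ∃ S : Finset (Fin n), S.card = s ∧ deg E S = d}

/-- `d(L, X^(i) Y^(j))`: the number of edges of the form `L ∪ I ∪ J` with
`I ∈ X^(i)`, `J ∈ Y^(j)` (take `Y = ∅`, `j = 0` when `Y^(j)` is omitted). -/
def degIn {n : ℕ} (E : Finset (Finset (Fin n))) (L X Y : Finset (Fin n)) (i j : ℕ) : ℕ :=
  (E.filter fun e =>
    L ⊆ e ∧ e \ L ⊆ X ∪ Y ∧ ((e \ L) ∩ X).card = i ∧ ((e \ L) ∩ Y).card = j).card

/-- The `i`-th edge of an ℓ-cycle given by the cyclic ordering `f` of the `n`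
vertices: `k` cyclically consecutive vertices starting at position `i * (k - ℓ)`. -/
def cycEdge (n k ℓ : ℕ) (f : ℕ → Fin n) (i : ℕ) : Finset (Fin n) :=
  (Finset.range k).image fun j => f ((i * (k - ℓ) + j) % n)

/-- `H = (Fin n, E)` contains a Hamiltonian ℓ-cycle: there is a cyclic ordering of
all `n` vertices such that each of the `n / (k - ℓ)` windows of `k` consecutive
vertices (consecutive windows overlapping in `ℓ` vertices) is an edge, and two
consecutive edges share exactly `ℓ` vertices. -/
def HasHamCycle (n k ℓ : ℕ) (E : Finset (Finset (Fin n))) : Prop :=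
  ∃ f : ℕ → Fin n, Set.InjOn f (Set.Iio n) ∧
    (∀ i < n / (k - ℓ), cycEdge n k ℓ f i ∈ E) ∧
    (∀ i < n / (k - ℓ),
      (cycEdge n k ℓ f i ∩ cycEdge n k ℓ f ((i + 1) % (n / (k - ℓ)))).card = ℓ)

/-- The `i`-th edge of an ℓ-path given by the linear ordering `f`. -/
def pathEdge (n k ℓ : ℕ) (f : ℕ → Fin n) (i : ℕ) : Finset (Fin n) :=
  (Finset.range k).image fun j => f (i * (k - ℓ) + j)

/-- `f` is (the linear ordering of the vertices of) an ℓ-path with `t` edges all of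
which belong to `E`: the path has `t * (k - ℓ) + ℓ` vertices, every edge consists of
`k` consecutive vertices and two consecutive edges intersect in exactly `ℓ` vertices. -/
def IsPath (n k ℓ t : ℕ) (E : Finset (Finset (Fin n))) (f : ℕ → Fin n) : Prop :=
  Set.InjOn f (Set.Iio (t * (k - ℓ) + ℓ)) ∧ ∀ i < t, pathEdge n k ℓ f i ∈ E

/-- The vertex set of the ℓ-path described by `f` with `t` edges. -/
def pathVerts (n k ℓ t : ℕ) (f : ℕ → Fin n) : Finset (Fin n) :=
  (Finset.range (t * (k - ℓ) + ℓ)).image f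

/-- The first end (first `ℓ` vertices) of the ℓ-path described by `f`. -/
def pathEnd0 (n ℓ : ℕ) (f : ℕ → Fin n) : Finset (Fin n) :=
  (Finset.range ℓ).image f

/-- The last end (last `ℓ` vertices) of the ℓ-path described by `f` with `t` edges. -/
def pathEnd1 (n k ℓ t : ℕ) (f : ℕ → Fin n) : Finset (Fin n) :=
  (Finset.Ico (t * (k - ℓ)) (t * (k - ℓ) + ℓ)).image f

/-- The extremal hypergraph `X_{k,ℓ}(n)` on `Fin n`.  If `n` is an odd multiple of
`k - ℓ`, take `A` to be the first `⌊n / (2(k-ℓ))⌋` vertices and all `k`-sets meeting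
`A` as edges.  If `n` is an even multiple of `k - ℓ`, take `A` to be the first
`n / (2(k-ℓ)) - 1` vertices, fix the `ℓ + 1` following vertices (which lie in
`B = V ∖ A`), and take as edges all `k`-sets meeting `A` together with all `k`-subsets
of `B` containing all `ℓ + 1` fixed vertices. -/
def Xedges (n k ℓ : ℕ) : Finset (Finset (Fin n)) :=
  if Odd (n / (k - ℓ)) then
    (Finset.powersetCard k (Finset.univ : Finset (Fin n))).filter fun e =>
      ∃ v ∈ e, (v : ℕ) < n / (2 * (k - ℓ))
  else
    (Finset.powersetCard k (Finset.univ : Finset (Fin n))).filter fun e =>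
      (∃ v ∈ e, (v : ℕ) < n / (2 * (k - ℓ)) - 1) ∨
      ((∀ v ∈ e, n / (2 * (k - ℓ)) - 1 ≤ (v : ℕ)) ∧
        ∀ w : Fin n, n / (2 * (k - ℓ)) - 1 ≤ (w : ℕ) → (w : ℕ) < n / (2 * (k - ℓ)) + ℓ →
          w ∈ e)

/-- `e(B)`: the number of edges lying entirely inside `B`. -/
def edgesIn {n : ℕ} (E : Finset (Finset (Fin n))) (B : Finset (Fin n)) : ℕ :=
  (E.filter fun e => e ⊆ B).card

/-- `(A, B)` is an `(ℓ,ξ)`-extremal partition of the vertex set: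
`|A| = ⌈n/(2(k-ℓ))⌉ - 1`, `|B| = ⌊(2(k-ℓ)-1)n/(2(k-ℓ)) + 1⌋` and
`e(B) ≤ ξ · C(n,k)`. -/
def IsExtremalPartition (n k ℓ : ℕ) (E : Finset (Finset (Fin n))) (ξ : ℝ)
    (A B : Finset (Fin n)) : Prop :=
  Disjoint A B ∧ A ∪ B = Finset.univ ∧
  A.card = ⌈(n : ℝ) / (2 * ((k - ℓ : ℕ) : ℝ))⌉₊ - 1 ∧
  B.card = ⌊(2 * ((k - ℓ : ℕ) : ℝ) - 1) * (n : ℝ) / (2 * ((k - ℓ : ℕ) : ℝ)) + 1⌋₊ ∧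
  (edgesIn E B : ℝ) ≤ ξ * (n.choose k : ℝ)

/-- `H` is `(ℓ,ξ)`-extremal. -/
def IsExtremal (n k ℓ : ℕ) (E : Finset (Finset (Fin n))) (ξ : ℝ) : Prop :=
  ∃ A B, IsExtremalPartition n k ℓ E ξ A B

/-- `(A, B)` is a minimal `(ℓ,ξ)`-extremal partition: among all `(ℓ,ξ)`-extremal
partitions it minimises `e(B)`. -/
def IsMinExtremalPartition (n k ℓ : ℕ) (E : Finset (Finset (Fin n))) (ξ : ℝ)
    (A B : Finset (Fin n)) : Prop :=
  IsExtremalPartition n k ℓ E ξ A B ∧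
  ∀ A' B' : Finset (Fin n), IsExtremalPartition n k ℓ E ξ A' B' →
    edgesIn E B ≤ edgesIn E B'

open scoped Classical in
/-- `A_ε`: the set of vertices `v` with `d(v, B^(k-1)) ≥ (1-ε)·C(|B|, k-1)`. -/
noncomputable def Aeps (n k : ℕ) (E : Finset (Finset (Fin n))) (B : Finset (Fin n)) (ε : ℝ) :
    Finset (Fin n) :=
  Finset.univ.filter fun v =>
    (1 - ε) * (B.card.choose (k - 1) : ℝ) ≤ (degIn E {v} B ∅ (k - 1) 0 : ℝ)

open scoped Classical in
/-- `B_ε`: the set of vertices `v` with `d(v, B^(k-1)) ≤ ε·C(|B|, k-1)`. -/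
noncomputable def Beps (n k : ℕ) (E : Finset (Finset (Fin n))) (B : Finset (Fin n)) (ε : ℝ) :
    Finset (Fin n) :=
  Finset.univ.filter fun v =>
    (degIn E {v} B ∅ (k - 1) 0 : ℝ) ≤ ε * (B.card.choose (k - 1) : ℝ)

/-- `V_ε = V ∖ (A_ε ∪ B_ε)`. -/
noncomputable def Veps (n k : ℕ) (E : Finset (Finset (Fin n))) (B : Finset (Fin n)) (ε : ℝ) :
    Finset (Fin n) :=
  Finset.univ \ (Aeps n k E B ε ∪ Beps n k E B ε)

/-- `L` is an ε-typical ℓ-set: `L ⊆ B_ε`, `|L| = ℓ` and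
`d(L, B^(k-ℓ)) ≤ ε·C(|B|, k-ℓ)`. -/
def IsTypical (n k ℓ : ℕ) (E : Finset (Finset (Fin n))) (B : Finset (Fin n)) (ε : ℝ)
    (L : Finset (Fin n)) : Prop :=
  L.card = ℓ ∧ L ⊆ Beps n k E B ε ∧
    (degIn E L B ∅ (k - ℓ) 0 : ℝ) ≤ ε * (B.card.choose (k - ℓ) : ℝ)

/-- The number of edges that contain `L` and have all their other vertices in `B`. -/
def codeg {n : ℕ} (E : Finset (Finset (Fin n))) (B L : Finset (Fin n)) : ℕ :=
  (E.filter fun e => L ⊆ e ∧ e \ L ⊆ B).card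

theorem degIn_eq_codeg {n k i : ℕ} {E : Finset (Finset (Fin n))} (hE : Uniform n k E)
    (B L : Finset (Fin n)) (hL : L.card + i = k) : degIn E L B ∅ i 0 = codeg E B L := by
  unfold degIn codeg
  congr 1
  apply filter_congr
  intro e he
  constructor
  · rintro ⟨h1, h2, -⟩
    exact ⟨h1, by simpa using h2⟩
  · rintro ⟨h1, h2⟩
    refine ⟨h1, by simpa using h2, ?_, by simp⟩
    rw [inter_eq_left.2 h2, card_sdiff_of_subset h1, hE e he]
    omega

theorem sum_codeg_le {n k : ℕ} {E : Finset (Finset (Fin n))} (hE : Uniform n k E)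
    (B J : Finset (Fin n)) (j : ℕ) :
    ∑ T ∈ powersetCard j (B \ J), codeg E B (J ∪ T) ≤ 2 ^ k * codeg E B J := by
  unfold codeg
  simp_rw [card_filter]
  rw [sum_comm, mul_sum]
  apply sum_le_sum
  intro e he
  split_ifs with h
  · rw [← card_filter, mul_one, ← hE e he, ← card_powerset]
    apply card_le_card
    intro T hT
    simp only [mem_filter, mem_powerset] at hT ⊢
    exact subset_union_right.trans hT.2.1
  · rw [mul_zero, Nat.le_zero, sum_eq_zero_iff]
    intro T hT
    rw [if_neg]
    rintro ⟨h1, h2⟩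
    apply h
    refine ⟨subset_union_left.trans h1, ?_⟩
    intro x hx
    by_cases hxT : x ∈ T
    · exact (mem_sdiff.1 ((mem_powersetCard.1 hT).1 hxT)).1
    · apply h2
      simp only [mem_sdiff, mem_union] at hx ⊢
      tauto

/-- Few sets extend `J` to a set of large codegree, if `J` has small codegree. -/
theorem card_extensions_mul_le {n k : ℕ} {E : Finset (Finset (Fin n))} (hE : Uniform n k E)
    (B J : Finset (Fin n)) (j : ℕ) (F : Finset (Finset (Fin n))) (τ : ℝ)
    (hF : ∀ T ∈ F, T ⊆ B \ J ∧ T.card = j ∧ τ ≤ codeg E B (J ∪ T)) :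
    F.card * τ ≤ 2 ^ k * codeg E B J := by
  have h1 : F ⊆ powersetCard j (B \ J) := fun T hT =>
    mem_powersetCard.2 ⟨(hF T hT).1, (hF T hT).2.1⟩
  have h2 := (sum_le_sum_of_subset (f := fun T => codeg E B (J ∪ T)) h1).trans
    (sum_codeg_le hE B J j)
  have h3 : F.card * τ ≤ ∑ T ∈ F, (codeg E B (J ∪ T) : ℝ) := by
    rw [← nsmul_eq_mul]
    exact card_nsmul_le_sum _ _ _ fun T hT => (hF T hT).2.2
  refine h3.trans ?_
  exact_mod_cast h2

/-- Every `(k-2)`-set has larger degree than in the hypergraph of all `k`-sets that are not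
contained in `B`. -/
def LargeDegree (n k : ℕ) (E : Finset (Finset (Fin n))) (B : Finset (Fin n)) : Prop :=
  ∀ S : Finset (Fin n), S.card = k - 2 →
    (n - (k - 2)).choose 2 < deg E S + (B.card - (k - 2)).choose 2

theorem card_missing_le_codeg {n k : ℕ} {E : Finset (Finset (Fin n))} (hk : 3 ≤ k)
    (hE : Uniform n k E) {B : Finset (Fin n)} (hdeg : LargeDegree n k E B)
    {S : Finset (Fin n)} (hS : S.card = k - 2) :
    ((powersetCard k univ).filter fun e => S ⊆ e ∧ e ∉ E ∧ ¬ e \ S ⊆ B).card ≤ codeg E B S := by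
  have h1 := hdeg S hS
  have h2 := card_filter_powersetCard_subset S univ k (subset_univ S) (by omega)
  have h3 := card_filter_powersetCard_subset S (S ∪ B) k subset_union_left (by omega)
  rw [card_univ, Fintype.card_fin, hS, show k - (k - 2) = 2 by omega] at h2
  rw [hS, show k - (k - 2) = 2 by omega] at h3
  have h4 : (B.card - (k - 2)).choose 2 ≤ ((S ∪ B).card - (k - 2)).choose 2 :=
    Nat.choose_le_choose _ (Nat.sub_le_sub_right (card_le_card subset_union_right) _)
  set P := (powersetCard k univ).filter fun e => S ⊆ e ∧ e ∉ E ∧ ¬ e \ S ⊆ B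
  set Q := (powersetCard k (S ∪ B)).filter fun e => S ⊆ e ∧ e ∉ E
  have h5 : (P ∪ Q ∪ E.filter fun e => S ⊆ e).card = P.card + Q.card + deg E S := by
    rw [card_union_of_disjoint, card_union_of_disjoint, deg]
    · rw [disjoint_left]
      intro e he he'
      simp only [P, Q, mem_filter, mem_powersetCard] at he he'
      apply he.2.2.2
      exact sdiff_le_iff.2 he'.1.1
    · rw [disjoint_left]
      intro e he he'
      simp only [P, Q, mem_filter, mem_union] at he he'
      tauto
  have h6 : (P ∪ Q ∪ E.filter fun e => S ⊆ e).card ≤ (n - (k - 2)).choose 2 := by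
    rw [← h2]
    apply card_le_card
    intro e he
    simp only [P, Q, mem_filter, mem_union, mem_powersetCard, subset_univ, true_and] at he ⊢
    rcases he with (he | he) | he
    · exact ⟨he.1, he.2.1⟩
    · exact ⟨he.1.2, he.2.1⟩
    · exact ⟨hE e he.1, he.2⟩
  have h7 : ((S ∪ B).card - (k - 2)).choose 2 ≤ Q.card + codeg E B S := by
    rw [← h3, codeg]
    refine (card_le_card ?_).trans (card_union_le _ _)
    intro e he
    simp only [Q, mem_filter, mem_union, mem_powersetCard] at he ⊢
    have : e \ S ⊆ B := sdiff_le_iff.2 he.1.1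
    tauto
  omega

/-- Few sets with exactly one vertex outside `B` fail to extend `M` to an edge, if `M` has small
codegree. -/
theorem card_missing_extensions_le {n k : ℕ} {E : Finset (Finset (Fin n))} (hk : 3 ≤ k)
    (hE : Uniform n k E) {B : Finset (Fin n)} (hdeg : LargeDegree n k E B)
    {M : Finset (Fin n)} (hM : M.card + 2 ≤ k) (F : Finset (Finset (Fin n)))
    (hF : ∀ X ∈ F, ∃ a R, a ∉ B ∧ a ∉ M ∧ R ⊆ B \ M ∧ R.card + 1 + M.card = k ∧
      X = insert a R ∧ M ∪ X ∉ E) :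
    F.card ≤ 2 ^ k * codeg E B M := by
  refine le_trans ?_ (sum_codeg_le hE B M (k - 2 - M.card))
  set miss : Finset (Fin n) → Finset (Finset (Fin n)) := fun S =>
    (powersetCard k univ).filter fun e => S ⊆ e ∧ e ∉ E ∧ ¬ e \ S ⊆ B
  have h1 : F ⊆ (powersetCard (k - 2 - M.card) (B \ M)).biUnion fun T =>
      (miss (M ∪ T)).image fun e => e \ M := by
    intro X hX
    obtain ⟨a, R, haB, haM, hR, hc, rfl, hXE⟩ := hF X hX
    obtain ⟨T, hTR, hT⟩ := exists_subset_card_eq (show k - 2 - M.card ≤ R.card by omega)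
    have haR : a ∉ R := fun h => haB (mem_sdiff.1 (hR h)).1
    have hdis : Disjoint M (insert a R) := by
      rw [disjoint_insert_right]
      exact ⟨haM, disjoint_of_subset_right hR disjoint_sdiff⟩
    simp only [mem_biUnion, mem_powersetCard, mem_image, miss, mem_filter, subset_univ, true_and]
    refine ⟨T, ⟨hTR.trans hR, hT⟩, M ∪ insert a R, ⟨?_, ?_, hXE, ?_⟩, ?_⟩
    · rw [card_union_of_disjoint hdis, card_insert_of_notMem haR]
      omega
    · exact union_subset_union le_rfl (hTR.trans (subset_insert _ _))
    · intro h
      apply haB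
      apply h
      simp only [mem_sdiff, mem_union, mem_insert, true_or, or_true, true_and]
      rintro (h | h)
      exacts [haM h, haR (hTR h)]
    · rw [union_sdiff_cancel_left hdis]
  refine (card_le_card h1).trans (card_biUnion_le.trans (sum_le_sum fun T hT => ?_))
  rw [mem_powersetCard] at hT
  refine card_image_le.trans (card_missing_le_codeg hk hE hdeg ?_)
  rw [card_union_of_disjoint (disjoint_of_subset_right hT.1 disjoint_sdiff), hT.2]
  omega

theorem ceil_div_two_mul {n d : ℕ} (hd : 0 < d) (hdn : d ∣ n) :
    ⌈(n : ℝ) / (2 * (d : ℝ))⌉₊ = (n / d + 1) / 2 := by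
  obtain ⟨t, rfl⟩ := hdn
  rw [Nat.mul_div_cancel_left _ hd]
  have hd' : (d : ℝ) ≠ 0 := by positivity
  have h : ((d * t : ℕ) : ℝ) / (2 * (d : ℝ)) = (t : ℝ) / 2 := by
    push_cast
    field_simp
  rw [h]
  apply le_antisymm
  · rw [Nat.ceil_le, div_le_iff₀ (by norm_num)]
    exact_mod_cast (show t ≤ (t + 1) / 2 * 2 by omega)
  · have h1 : (t : ℝ) ≤ ⌈(t : ℝ) / 2⌉₊ * 2 := by
      rw [← div_le_iff₀ (by norm_num)]
      exact Nat.le_ceil _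
    have h2 : t ≤ ⌈(t : ℝ) / 2⌉₊ * 2 := by exact_mod_cast h1
    omega

theorem filter_lt_subset_Xedges {n k ℓ : ℕ} (hlk : ℓ < k) :
    ((powersetCard k (univ : Finset (Fin n))).filter fun e =>
      ∃ v : Fin n, v ∈ e ∧ (v : ℕ) < (n / (k - ℓ) + 1) / 2 - 1) ⊆ Xedges n k ℓ := by
  have hd : 0 < k - ℓ := by omega
  have h : n / (2 * (k - ℓ)) = n / (k - ℓ) / 2 := by
    rw [Nat.div_div_eq_div_mul, mul_comm]
  intro e he
  rw [mem_filter] at he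
  obtain ⟨he, v, hv, hva⟩ := he
  unfold Xedges
  rw [h]
  split_ifs with hodd
  · rw [mem_filter]
    exact ⟨he, v, hv, by omega⟩
  · rw [mem_filter]
    refine ⟨he, Or.inl ⟨v, hv, ?_⟩⟩
    rw [Nat.not_odd_iff_even] at hodd
    obtain ⟨s, hs⟩ := hodd
    omega

theorem choose_le_deg_Xedges {n k ℓ : ℕ} (hk : 3 ≤ k) (hlk : ℓ < k)
    (S : Finset (Fin n)) (hS : S.card = k - 2) :
    (n - (k - 2)).choose 2 ≤ deg (Xedges n k ℓ) S +
      (n - ((n / (k - ℓ) + 1) / 2 - 1) - (k - 2)).choose 2 := by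
  set a := (n / (k - ℓ) + 1) / 2 - 1
  have h1 := card_filter_powersetCard_subset S univ k (subset_univ S) (by omega)
  rw [card_univ, Fintype.card_fin, hS, show k - (k - 2) = 2 by omega] at h1
  set Q : Finset (Fin n) := univ.filter fun v => a ≤ (v : ℕ)
  have hQ : Q.card = n - a := by
    have h2 : (univ.filter fun v : Fin n => (v : ℕ) < a).card = min n a := by
      rw [Fin.card_filter_val_lt]
    have h3 := card_filter_add_card_filter_not (s := (univ : Finset (Fin n)))
      (fun v : Fin n => (v : ℕ) < a)
    simp only [not_lt, card_univ, Fintype.card_fin] at h3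
    change _ + Q.card = n at h3
    omega
  have h4 : ((powersetCard k Q).filter fun e => S ⊆ e).card ≤ (n - a - (k - 2)).choose 2 := by
    by_cases hSQ : S ⊆ Q
    · rw [card_filter_powersetCard_subset S Q k hSQ (by omega), hQ, hS,
        show k - (k - 2) = 2 by omega]
    · rw [filter_eq_empty_iff.2, card_empty]
      · exact Nat.zero_le _
      · intro e he h
        exact hSQ (h.trans (mem_powersetCard.1 he).1)
  refine le_trans ?_ (Nat.add_le_add_left h4 _)
  rw [← h1, deg]
  refine (card_le_card ?_).trans (card_union_le _ _)
  intro e he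
  rw [mem_filter] at he
  rw [mem_union, mem_filter, mem_filter]
  by_cases heQ : e ⊆ Q
  · exact Or.inr ⟨mem_powersetCard.2 ⟨heQ, (mem_powersetCard.1 he.1).2⟩, he.2⟩
  · left
    refine ⟨filter_lt_subset_Xedges hlk ?_, he.2⟩
    rw [not_subset] at heQ
    obtain ⟨v, hv, hvQ⟩ := heQ
    rw [mem_filter]
    refine ⟨he.1, v, hv, ?_⟩
    simpa [Q] using hvQ

theorem largeDegree_of_minDeg_lt {n k ℓ : ℕ} (hk : 3 ≤ k) (hlk : ℓ < k)
    {E : Finset (Finset (Fin n))} {B : Finset (Fin n)}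
    (hB : B.card = n - ((n / (k - ℓ) + 1) / 2 - 1))
    (h : minDeg n (Xedges n k ℓ) (k - 2) < minDeg n E (k - 2)) : LargeDegree n k E B := by
  intro S hS
  have hne : {d | ∃ S : Finset (Fin n), S.card = k - 2 ∧ deg (Xedges n k ℓ) S = d}.Nonempty :=
    ⟨_, S, hS, rfl⟩
  obtain ⟨S₀, hS₀, hd⟩ := Nat.sInf_mem hne
  change _ = minDeg n (Xedges n k ℓ) (k - 2) at hd
  have h1 := choose_le_deg_Xedges hk hlk S₀ hS₀
  have h2 : minDeg n E (k - 2) ≤ deg E S := Nat.sInf_le ⟨S, hS, rfl⟩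
  rw [← hB] at h1
  omega

theorem edgesIn_eq_add_codeg {n : ℕ} (E : Finset (Finset (Fin n))) {B : Finset (Fin n)}
    {b : Fin n} (hb : b ∈ B) : edgesIn E B = edgesIn E (B.erase b) + codeg E B {b} := by
  unfold edgesIn codeg
  rw [← card_union_of_disjoint]
  · congr 1
    ext e
    simp only [mem_filter, mem_union, singleton_subset_iff, subset_erase, sdiff_singleton_eq_erase]
    constructor
    · rintro ⟨h1, h2⟩
      by_cases hbe : b ∈ e
      · exact Or.inr ⟨h1, hbe, (erase_subset _ _).trans h2⟩
      · exact Or.inl ⟨h1, h2, hbe⟩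
    · rintro (⟨h1, h2, h3⟩ | ⟨h1, h2, h3⟩)
      · exact ⟨h1, h2⟩
      · refine ⟨h1, ?_⟩
        rw [← insert_erase h2]
        exact insert_subset hb h3
  · rw [disjoint_left]
    intro e h1 h2
    simp only [mem_filter, singleton_subset_iff, subset_erase] at h1 h2
    exact h1.2.2 h2.2.1

theorem mem_Beps {n k : ℕ} (hk : 1 ≤ k) {E : Finset (Finset (Fin n))} (hE : Uniform n k E)
    {B : Finset (Fin n)} {ε : ℝ} {v : Fin n} :
    v ∈ Beps n k E B ε ↔ (codeg E B {v} : ℝ) ≤ ε * (B.card.choose (k - 1) : ℝ) := by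
  rw [Beps, mem_filter, degIn_eq_codeg hE _ _ (by rw [card_singleton]; omega)]
  simp

theorem mem_Aeps {n k : ℕ} (hk : 1 ≤ k) {E : Finset (Finset (Fin n))} (hE : Uniform n k E)
    {B : Finset (Fin n)} {ε : ℝ} {v : Fin n} :
    v ∈ Aeps n k E B ε ↔ (1 - ε) * (B.card.choose (k - 1) : ℝ) ≤ codeg E B {v} := by
  rw [Aeps, mem_filter, degIn_eq_codeg hE _ _ (by rw [card_singleton]; omega)]
  simp

theorem subset_Beps_of_minimal {n k ℓ : ℕ} (hk : 1 ≤ k) {E : Finset (Finset (Fin n))}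
    (hE : Uniform n k E) {A B : Finset (Fin n)} {ξ ε : ℝ}
    (h : IsMinExtremalPartition n k ℓ E ξ A B) (hq : (A ∩ Beps n k E B ε).Nonempty) :
    B ⊆ Beps n k E B ε := by
  obtain ⟨v, hv⟩ := hq
  rw [mem_inter, mem_Beps hk hE] at hv
  obtain ⟨hvA, hv⟩ := hv
  obtain ⟨⟨hdis, hun, hA, hB, hξ⟩, hmin⟩ := h
  intro b hb
  rw [mem_Beps hk hE]
  have hvB : v ∉ B := disjoint_left.1 hdis hvA
  have hbA : b ∉ A := disjoint_right.1 hdis hb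
  have hbv : b ≠ v := fun h => hvB (h ▸ hb)
  have hvB' : v ∉ B.erase b := fun h => hvB (mem_of_mem_erase h)
  have hbA' : b ∉ A.erase v := fun h => hbA (mem_of_mem_erase h)
  have hle : edgesIn E B ≤ edgesIn E (insert v (B.erase b)) := by
    by_contra! hlt
    refine absurd (hmin (insert b (A.erase v)) (insert v (B.erase b)) ⟨?_, ?_, ?_, ?_, ?_⟩)
      (not_le.2 hlt)
    · simp only [disjoint_insert_left, disjoint_insert_right, mem_insert, mem_erase]
      refine ⟨by simpa using hbv.symm, by simp, ?_⟩
      exact hdis.mono (erase_subset _ _) (erase_subset _ _)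
    · rw [eq_univ_iff_forall] at hun ⊢
      intro x
      have := hun x
      simp only [mem_union, mem_insert, mem_erase] at this ⊢
      tauto
    · rw [card_insert_of_notMem hbA', card_erase_of_mem hvA, ← hA]
      have := card_pos.2 ⟨v, hvA⟩
      omega
    · rw [card_insert_of_notMem hvB', card_erase_of_mem hb, ← hB]
      have := card_pos.2 ⟨b, hb⟩
      omega
    · refine le_trans ?_ hξ
      exact_mod_cast hlt.le
  rw [edgesIn_eq_add_codeg E hb, edgesIn_eq_add_codeg E (mem_insert_self v _),
    erase_insert hvB'] at hle
  have h1 : codeg E (insert v (B.erase b)) {v} ≤ codeg E B {v} := by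
    apply card_le_card
    apply monotone_filter_right
    rintro e - ⟨h1, h2⟩
    refine ⟨h1, fun x hx => ?_⟩
    have := h2 hx
    simp only [mem_insert, mem_erase, mem_sdiff, mem_singleton] at this hx
    tauto
  refine le_trans ?_ hv
  exact_mod_cast (show codeg E B {b} ≤ codeg E B {v} by omega)

theorem card_filter_image_mem_le {n r k : ℕ} (hk : 1 ≤ k) (hr : r ≤ 2 * k) (I : Finset (Fin r))
    (F : Finset (Finset (Fin n))) {η : ℝ} (hF : ∀ X ∈ F, X.card ≤ k)
    (hη : (F.card : ℝ) ≤ η * (n : ℝ) ^ I.card) :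
    ((univ.filter fun g : Fin r → Fin n => I.image g ∈ F).card : ℝ) ≤
      η * (k : ℝ) ^ (2 * k) * (n : ℝ) ^ r := by
  have hI : I.card ≤ r := by simpa using card_le_univ I
  have h1 : (univ.filter fun g : Fin r → Fin n => I.image g ∈ F) ⊆
      F.biUnion fun X => Fintype.piFinset fun i => if i ∈ I then X else univ := by
    intro g hg
    rw [mem_filter] at hg
    rw [mem_biUnion]
    refine ⟨_, hg.2, ?_⟩
    rw [Fintype.mem_piFinset]
    intro i
    split_ifs with h
    · exact mem_image_of_mem _ h
    · exact mem_univ _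
  have h2 : ∀ X ∈ F, (Fintype.piFinset fun i => if i ∈ I then X else univ).card ≤
      k ^ (2 * k) * n ^ (r - I.card) := by
    intro X hX
    rw [Fintype.card_piFinset]
    have h3 : ∀ i : Fin r, (if i ∈ I then X else univ).card = if i ∈ I then X.card else n := by
      intro i
      split_ifs <;> simp
    rw [prod_congr rfl fun i _ => h3 i, prod_ite, prod_const, prod_const]
    simp only [filter_univ_mem]
    rw [filter_not, filter_univ_mem, card_univ_sdiff, Fintype.card_fin]
    apply Nat.mul_le_mul_right
    exact (Nat.pow_le_pow_left (hF X hX) _).trans (Nat.pow_le_pow_right hk (hI.trans hr))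
  have h3 := (card_le_card h1).trans (card_biUnion_le_card_mul _ _ _ h2)
  calc ((univ.filter fun g : Fin r → Fin n => I.image g ∈ F).card : ℝ)
      ≤ F.card * ((k : ℝ) ^ (2 * k) * (n : ℝ) ^ (r - I.card)) := by exact_mod_cast h3
    _ ≤ (η * (n : ℝ) ^ I.card) * ((k : ℝ) ^ (2 * k) * (n : ℝ) ^ (r - I.card)) := by gcongr
    _ = η * (k : ℝ) ^ (2 * k) * ((n : ℝ) ^ I.card * (n : ℝ) ^ (r - I.card)) := by ring
    _ = η * (k : ℝ) ^ (2 * k) * (n : ℝ) ^ r := by rw [← pow_add, Nat.add_sub_cancel' hI]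

/-- A dense family of tuples contains an injective one that avoids a small vertex set and three
sparse families of sets. -/
theorem exists_injective_tuple {n r k : ℕ} (hk : 3 ≤ k) (hr : r ≤ 2 * k)
    (G : Finset (Fin r → Fin n)) (Z : Finset (Fin n)) (I : Fin 3 → Finset (Fin r))
    (F : Fin 3 → Finset (Finset (Fin n))) {η c : ℝ} (hF : ∀ i, ∀ X ∈ F i, X.card ≤ k)
    (hη : ∀ i, ((F i).card : ℝ) ≤ η * (n : ℝ) ^ (I i).card) (hZ : (Z.card : ℝ) ≤ η * n)
    (hn : 1 ≤ η * n) (hG : c * (n : ℝ) ^ r ≤ G.card)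
    (hc : 9 * (k : ℝ) ^ 2 * (k : ℝ) ^ (2 * k) * η < c) :
    ∃ g ∈ G, Function.Injective g ∧ (∀ i, g i ∉ Z) ∧ ∀ i, (I i).image g ∉ F i := by
  have hn0 : 0 < n := by
    rcases Nat.eq_zero_or_pos n with rfl | h
    · norm_num at hn
    · exact h
  have hη0 : 0 < η := by
    by_contra! h
    have : η * n ≤ 0 := mul_nonpos_of_nonpos_of_nonneg h (Nat.cast_nonneg n)
    linarith
  by_contra! hcon
  set bad : Finset (Fin r) → Finset (Finset (Fin n)) → Finset (Fin r → Fin n) :=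
    fun I F => univ.filter fun g => I.image g ∈ F
  set u : ℝ := η * (k : ℝ) ^ (2 * k) * (n : ℝ) ^ r
  have hu : 0 < u := by positivity
  set P₁ := (univ : Finset (Fin r × Fin r)).filter fun p => p.1 ≠ p.2
  set U₁ := P₁.biUnion fun p => bad {p.1, p.2} (univ.image fun x => {x})
  set U₂ := (univ : Finset (Fin r)).biUnion fun i => bad {i} (Z.image fun x => {x})
  set U₃ := (univ : Finset (Fin 3)).biUnion fun i => bad (I i) (F i)
  have hsub : G ⊆ U₁ ∪ U₂ ∪ U₃ := by
    intro g hg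
    simp only [U₁, U₂, U₃, bad, P₁, mem_union, mem_biUnion, mem_filter, mem_univ, true_and,
      mem_image]
    by_cases hinj : Function.Injective g
    · by_cases hgZ : ∀ i, g i ∉ Z
      · right
        exact hcon g hg hinj hgZ
      · push Not at hgZ
        obtain ⟨i, hi⟩ := hgZ
        exact Or.inl (Or.inr ⟨i, g i, hi, by simp⟩)
    · unfold Function.Injective at hinj
      push Not at hinj
      obtain ⟨i, j, hij, hne⟩ := hinj
      exact Or.inl (Or.inl ⟨(i, j), hne, g i, by simp [image_insert, hij]⟩)
  have hk0 : (1 : ℝ) ≤ k := by exact_mod_cast (by omega : 1 ≤ k)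
  have h₁ : (U₁.card : ℝ) ≤ 4 * (k : ℝ) ^ 2 * u := by
    have h : ∀ p ∈ P₁, ((bad {p.1, p.2} (univ.image fun x => {x})).card : ℝ) ≤ u := by
      intro p hp
      apply card_filter_image_mem_le (by omega) hr
      · intro X hX
        obtain ⟨x, -, rfl⟩ := mem_image.1 hX
        rw [card_singleton]
        omega
      · rw [card_pair (mem_filter.1 hp).2]
        have h3 : ((univ.image fun x : Fin n => ({x} : Finset (Fin n))).card : ℝ) ≤ n := by
          exact_mod_cast card_image_le.trans (by simp)
        refine h3.trans ?_
        have : (0 : ℝ) ≤ n := Nat.cast_nonneg n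
        nlinarith
    have hP : (P₁.card : ℝ) ≤ 4 * (k : ℝ) ^ 2 := by
      have : P₁.card ≤ r * r := by simpa using card_le_univ P₁
      have h4 : r * r ≤ 4 * k ^ 2 := by nlinarith
      exact_mod_cast this.trans h4
    calc (U₁.card : ℝ) ≤ ∑ p ∈ P₁, ((bad {p.1, p.2} (univ.image fun x => {x})).card : ℝ) := by
          exact_mod_cast card_biUnion_le
      _ ≤ P₁.card • u := sum_le_card_nsmul _ _ _ h
      _ = P₁.card * u := nsmul_eq_mul _ _
      _ ≤ _ := by gcongr
  have h₂ : (U₂.card : ℝ) ≤ 2 * k * u := by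
    have h : ∀ i ∈ (univ : Finset (Fin r)),
        ((bad {i} (Z.image fun x => {x})).card : ℝ) ≤ u := by
      intro i _
      apply card_filter_image_mem_le (by omega) hr
      · intro X hX
        obtain ⟨x, -, rfl⟩ := mem_image.1 hX
        rw [card_singleton]
        omega
      · rw [card_singleton, pow_one]
        refine le_trans ?_ hZ
        exact_mod_cast card_image_le
    calc (U₂.card : ℝ) ≤ ∑ i : Fin r, ((bad {i} (Z.image fun x => {x})).card : ℝ) := by
          exact_mod_cast card_biUnion_le
      _ ≤ (univ : Finset (Fin r)).card • u := sum_le_card_nsmul _ _ _ h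
      _ = r * u := by rw [nsmul_eq_mul, card_univ, Fintype.card_fin]
      _ ≤ _ := by
        gcongr
        exact_mod_cast hr
  have h₃ : (U₃.card : ℝ) ≤ 3 * u := by
    calc (U₃.card : ℝ) ≤ ∑ i : Fin 3, ((bad (I i) (F i)).card : ℝ) := by
          exact_mod_cast card_biUnion_le
      _ ≤ (univ : Finset (Fin 3)).card • u := sum_le_card_nsmul _ _ _ fun i _ =>
          card_filter_image_mem_le (by omega) hr _ _ (hF i) (hη i)
      _ = 3 * u := by simp
  have h₄ : (G.card : ℝ) ≤ U₁.card + U₂.card + U₃.card := by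
    exact_mod_cast (card_le_card hsub).trans ((card_union_le _ _).trans
      (Nat.add_le_add_right (card_union_le _ _) _))
  have hk3 : (3 : ℝ) ≤ k := by exact_mod_cast hk
  have h₅ : (4 * (k : ℝ) ^ 2 + 2 * k + 3) * u ≤ 9 * (k : ℝ) ^ 2 * u := by
    gcongr
    nlinarith
  have h₆ : 9 * (k : ℝ) ^ 2 * u < c * (n : ℝ) ^ r := by
    have : 9 * (k : ℝ) ^ 2 * u = (9 * (k : ℝ) ^ 2 * (k : ℝ) ^ (2 * k) * η) * (n : ℝ) ^ r := by
      ring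
    rw [this]
    have : (0 : ℝ) < n := by exact_mod_cast hn0
    gcongr
  linarith

/-- If every small set of forbidden vertices is avoided by some object, then many objects with
disjoint vertex sets can be chosen greedily. -/
theorem exists_disjoint_family {α β : Type*} [DecidableEq α] (p : β → Prop) (verts : β → Finset α)
    (K N : ℕ) (hK : ∀ b, (verts b).card ≤ K)
    (h : ∀ Z : Finset α, Z.card ≤ K * N → ∃ b, p b ∧ Disjoint (verts b) Z) :
    ∃ F : Fin N → β, (∀ i, p (F i)) ∧ ∀ i j, i ≠ j → Disjoint (verts (F i)) (verts (F j)) := by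
  suffices H : ∀ m ≤ N, ∃ F : Fin m → β, (∀ i, p (F i)) ∧
      ∀ i j, i ≠ j → Disjoint (verts (F i)) (verts (F j)) from H N le_rfl
  intro m
  induction m with
  | zero => exact fun _ => ⟨fun i => i.elim0, fun i => i.elim0, fun i => i.elim0⟩
  | succ m ih =>
    intro hm
    obtain ⟨F, hF, hd⟩ := ih (by omega)
    obtain ⟨b, hb, hbd⟩ := h (univ.biUnion fun i => verts (F i)) <| by
      refine (card_biUnion_le_card_mul _ _ K fun i _ => hK _).trans ?_
      rw [card_univ, Fintype.card_fin, mul_comm]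
      exact Nat.mul_le_mul_left _ (by omega)
    rw [disjoint_biUnion_right] at hbd
    refine ⟨Fin.cons b F, ?_, ?_⟩
    · intro i
      refine Fin.cases ?_ (fun i => ?_) i
      · simpa using hb
      · simpa using hF i
    · intro i j
      refine Fin.cases ?_ (fun i => ?_) i <;> refine Fin.cases ?_ (fun j => ?_) j
      · simp
      · intro _
        simpa using hbd j (mem_univ _)
      · intro _
        simpa using (hbd i (mem_univ _)).symm
      · intro hij
        simpa using hd i j fun h => hij (by rw [h])

theorem exists_image_range_eq {α : Type*} [DecidableEq α] [Nonempty α] (s : Finset α) :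
    ∃ h : ℕ → α, (range s.card).image h = s := by
  refine ⟨fun j => if hj : j < s.card then s.equivFin.symm ⟨j, hj⟩ else Classical.arbitrary α, ?_⟩
  ext x
  simp only [mem_image, mem_range]
  constructor
  · rintro ⟨j, hj, rfl⟩
    simp [hj]
  · intro hx
    exact ⟨s.equivFin ⟨x, hx⟩, (s.equivFin ⟨x, hx⟩).2, by simp⟩

/-- Concatenation of sequences. -/
theorem exists_concat {α : Type*} [DecidableEq α] (p : ℕ) (f h : ℕ → α) :
    ∃ f' : ℕ → α, (∀ j < p, f' j = f j) ∧
      ∀ a b, (Ico (p + a) (p + b)).image f' = (Ico a b).image h := by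
  refine ⟨fun j => if j < p then f j else h (j - p), fun j hj => if_pos hj, fun a b => ?_⟩
  rw [← image_add_left_Ico, image_image]
  apply image_congr
  intro j _
  simp

theorem pathEdge_eq_image_Ico (n k ℓ : ℕ) (f : ℕ → Fin n) (i : ℕ) :
    pathEdge n k ℓ f i = (Ico (i * (k - ℓ)) (i * (k - ℓ) + k)).image f := by
  rw [pathEdge, range_eq_Ico, ← Nat.add_zero (i * (k - ℓ)), Nat.add_assoc, Nat.zero_add,
    ← image_add_left_Ico, image_image, Nat.add_zero]
  rfl

theorem exists_path {n k ℓ d : ℕ} (hlk : 2 * ℓ < k) (hd : d = k - ℓ) {E : Finset (Finset (Fin n))}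
    (g : Fin (2 * d) → Fin n) (hg : Function.Injective g) {e M L : Finset (Fin n)}
    (hec : e.card = k) (he : e ∈ E) (hM : M ⊆ e) (hL : L ⊆ e) (hML : Disjoint M L)
    (hMc : M.card = ℓ) (hLc : L.card = ℓ) (hge : ∀ i, g i ∉ e)
    (h₀ : (univ.filter fun i => i.val < k).image g ∈ E)
    (h₁ : M ∪ (univ.filter fun i => d ≤ i.val).image g ∈ E) :
    ∃ f : ℕ → Fin n, IsPath n k ℓ 3 E f ∧ pathVerts n k ℓ 3 f = univ.image g ∪ e ∧
      pathEnd0 n ℓ f = (univ.filter fun i => i.val < ℓ).image g ∧ pathEnd1 n k ℓ 3 f = L := by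
  have : Nonempty (Fin n) := ⟨g ⟨0, by omega⟩⟩
  obtain ⟨hM', hM'⟩ := exists_image_range_eq M
  obtain ⟨hL', hL'⟩ := exists_image_range_eq L
  obtain ⟨hR', hR'⟩ := exists_image_range_eq (e \ (M ∪ L))
  have hRc : (e \ (M ∪ L)).card = k - 2 * ℓ := by
    rw [card_sdiff_of_subset (union_subset hM hL), card_union_of_disjoint hML]
    omega
  rw [hMc] at hM'
  rw [hLc] at hL'
  rw [hRc] at hR'
  rename_i hMf hLf hRf
  obtain ⟨t, ht₀, ht⟩ := exists_concat (k - 2 * ℓ) hRf hLf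
  obtain ⟨s, hs₀, hs⟩ := exists_concat ℓ hMf t
  obtain ⟨f, hf₀, hf⟩ := exists_concat (2 * d)
    (fun j => if hj : j < 2 * d then g ⟨j, hj⟩ else Classical.arbitrary _) s
  have hfg : ∀ i : Fin (2 * d), f i = g i := by
    intro i
    rw [hf₀ i i.2, dif_pos i.2]
  have hIco : ∀ a b, b ≤ 2 * d →
      (Ico a b).image f = (univ.filter fun i : Fin (2 * d) => a ≤ i.val ∧ i.val < b).image g := by
    intro a b hb
    ext x
    simp only [mem_image, mem_Ico, mem_filter, mem_univ, true_and]
    constructor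
    · rintro ⟨j, hj, rfl⟩
      exact ⟨⟨j, by omega⟩, hj, (hfg _).symm⟩
    · rintro ⟨i, hi, rfl⟩
      exact ⟨i, hi, hfg i⟩
  have hfM : (Ico (2 * d) (2 * d + ℓ)).image f = M := by
    rw [← hM', ← Nat.add_zero (2 * d), Nat.add_assoc, Nat.zero_add, hf, ← range_eq_Ico]
    exact image_congr fun j hj => hs₀ j (by simpa using hj)
  have hfL : (Ico (3 * d) (3 * d + ℓ)).image f = L := by
    rw [← hL', show 3 * d = 2 * d + (ℓ + (k - 2 * ℓ + 0)) by omega, Nat.add_assoc (2 * d),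
      Nat.add_assoc ℓ, Nat.add_assoc (k - 2 * ℓ), hf, hs, ht, Nat.zero_add, range_eq_Ico]
  have hfR : (Ico (2 * d + ℓ) (3 * d)).image f = e \ (M ∪ L) := by
    rw [← hR', show 2 * d + ℓ = 2 * d + (ℓ + 0) by omega,
      show 3 * d = 2 * d + (ℓ + (k - 2 * ℓ)) by omega, hf, hs, ← range_eq_Ico]
    exact image_congr fun j hj => ht₀ j (by simpa using hj)
  have hfe : (Ico (2 * d) (2 * d + k)).image f = e := by
    rw [← Ico_union_Ico_eq_Ico (show 2 * d ≤ 2 * d + ℓ by omega)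
      (show 2 * d + ℓ ≤ 2 * d + k by omega), ← Ico_union_Ico_eq_Ico
      (show 2 * d + ℓ ≤ 3 * d by omega) (show 3 * d ≤ 2 * d + k by omega),
      show 2 * d + k = 3 * d + ℓ by omega, image_union, image_union, hfM, hfR, hfL]
    have h1 : M ∪ L ⊆ e := union_subset hM hL
    ext x
    have := @h1 x
    simp only [mem_union, mem_sdiff] at this ⊢
    tauto
  have hverts : pathVerts n k ℓ 3 f = univ.image g ∪ e := by
    rw [pathVerts, range_eq_Ico, ← Ico_union_Ico_eq_Ico (Nat.zero_le (2 * d))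
      (show 2 * d ≤ 3 * (k - ℓ) + ℓ by omega), image_union, hIco 0 _ le_rfl,
      show 3 * (k - ℓ) + ℓ = 2 * d + k by omega, hfe]
    congr 2
    ext i
    simp
  refine ⟨f, ⟨?_, ?_⟩, hverts, ?_, ?_⟩
  · have hc : (pathVerts n k ℓ 3 f).card = 3 * d + ℓ := by
      rw [hverts, card_union_of_disjoint, card_image_of_injective _ hg, card_univ,
        Fintype.card_fin, hec]
      · omega
      · rw [disjoint_left]
        intro x hx
        obtain ⟨i, -, rfl⟩ := mem_image.1 hx
        exact hge i
    have h2 : Set.InjOn f (range (3 * (k - ℓ) + ℓ)) := by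
      rw [← card_image_iff, card_range]
      exact hc.trans (by rw [hd])
    simpa using h2
  · intro i hi
    rw [pathEdge_eq_image_Ico, ← hd]
    interval_cases i
    · rw [hIco _ _ (by omega)]
      convert h₀ using 3
      simp
    · rw [← Ico_union_Ico_eq_Ico (show 1 * d ≤ 2 * d by omega) (show 2 * d ≤ 1 * d + k by omega),
        image_union, hIco _ _ le_rfl, show 1 * d + k = 2 * d + ℓ by omega, hfM, union_comm]
      convert h₁ using 4
      simp
    · rwa [hfe]
  · rw [pathEnd0, range_eq_Ico, hIco _ _ (by omega)]
    congr 1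
    ext i
    simp
  · rw [pathEnd1, ← hd, hfL]

theorem pow_le_choose_of_le {n b k j : ℕ} (hj : j ≤ k) (hn : 4 * k ≤ n) (hb : n ≤ 2 * b) :
    ((4 : ℝ) ^ k * (k.factorial : ℝ))⁻¹ * (n : ℝ) ^ j ≤ b.choose j := by
  rw [inv_mul_le_iff₀ (by positivity)]
  have h1 : ((b + 1 - j : ℕ) ^ j : ℝ) ≤ (j.factorial : ℝ) * b.choose j := by
    exact_mod_cast Nat.pow_sub_le_descFactorial b j |>.trans
      (Nat.descFactorial_eq_factorial_mul_choose b j).le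
  have h2 : (n : ℝ) ≤ 4 * ((b + 1 - j : ℕ) : ℝ) := by
    exact_mod_cast (show n ≤ 4 * (b + 1 - j) by omega)
  calc (n : ℝ) ^ j ≤ (4 * ((b + 1 - j : ℕ) : ℝ)) ^ j := by gcongr
    _ = 4 ^ j * ((b + 1 - j : ℕ) : ℝ) ^ j := mul_pow _ _ _
    _ ≤ 4 ^ k * ((j.factorial : ℝ) * b.choose j) := by
        gcongr
        norm_num
    _ ≤ 4 ^ k * ((k.factorial : ℝ) * b.choose j) := by
        gcongr
    _ = _ := by ring

theorem choose_cast_le_pow {n b j : ℕ} (hb : b ≤ n) : (b.choose j : ℝ) ≤ (n : ℝ) ^ j := by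
  exact_mod_cast (Nat.choose_le_pow b j).trans (Nat.pow_le_pow_left hb j)

theorem card_filter_val_Ico {r a b : ℕ} (hb : b ≤ r) :
    ((univ : Finset (Fin r)).filter fun i => a ≤ i.val ∧ i.val < b).card = b - a := by
  rw [← Nat.card_Ico, ← card_map Fin.valEmbedding]
  congr 1
  ext x
  simp only [mem_map, mem_filter, mem_univ, true_and, Fin.valEmbedding_apply, mem_Ico]
  constructor
  · rintro ⟨i, hi, rfl⟩
    exact hi
  · intro hx
    exact ⟨⟨x, by omega⟩, hx, rfl⟩

theorem card_heavy_extensions_le {n k ℓ s : ℕ} (hn : 0 < n) {E : Finset (Finset (Fin n))}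
    (hE : Uniform n k E) (B J : Finset (Fin n)) {σ η : ℝ} (hσ : 0 < σ)
    (hJ : (codeg E B J : ℝ) ≤ σ * η * (n : ℝ) ^ (k - ℓ + s)) :
    (((powersetCard s (B \ J)).filter fun T =>
      σ * (n : ℝ) ^ (k - ℓ) < codeg E B (J ∪ T)).card : ℝ) ≤ 2 ^ k * η * (n : ℝ) ^ s := by
  set F := (powersetCard s (B \ J)).filter fun T => σ * (n : ℝ) ^ (k - ℓ) < codeg E B (J ∪ T)
  have h := card_extensions_mul_le hE B J s F (σ * (n : ℝ) ^ (k - ℓ)) fun T hT => by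
    simp only [F, mem_filter, mem_powersetCard] at hT
    exact ⟨hT.1.1, hT.1.2, hT.2.le⟩
  have hn' : (0 : ℝ) < n := by exact_mod_cast hn
  have h2 : (F.card : ℝ) * (σ * (n : ℝ) ^ (k - ℓ)) ≤
      (2 ^ k * η * (n : ℝ) ^ s) * (σ * (n : ℝ) ^ (k - ℓ)) := by
    calc _ ≤ (2 : ℝ) ^ k * codeg E B J := h
      _ ≤ 2 ^ k * (σ * η * (n : ℝ) ^ (k - ℓ + s)) := by gcongr
      _ = _ := by rw [pow_add]; ring
  exact le_of_mul_le_mul_right h2 (by positivity)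

theorem codeg_le_card_tuples {n k : ℕ} {E : Finset (Finset (Fin n))} (hE : Uniform n k E)
    (B J : Finset (Fin n)) :
    codeg E B J ≤ (univ.filter fun g : Fin (k - J.card) → Fin n =>
      J ∪ univ.image g ∈ E ∧ univ.image g ⊆ B ∧ Disjoint J (univ.image g)).card := by
  refine (card_le_card ?_).trans (card_image_le (f := fun g => J ∪ univ.image g))
  intro e he
  rw [mem_filter] at he
  obtain ⟨heE, hJ, hB⟩ := he
  have hc : (e \ J).card = k - J.card := by rw [card_sdiff_of_subset hJ, hE e heE]
  rw [mem_image]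
  have himg : univ.image ((e \ J).orderEmbOfFin hc) = e \ J := image_orderEmbOfFin_univ _ _
  refine ⟨(e \ J).orderEmbOfFin hc, ?_, ?_⟩
  · rw [mem_filter]
    refine ⟨mem_univ _, ?_, ?_, ?_⟩
    · rwa [himg, union_sdiff_of_subset hJ]
    · rwa [himg]
    · rw [himg]
      exact disjoint_sdiff
  · rw [himg, union_sdiff_of_subset hJ]

/-- If some edge inside `U` avoids a small set `Z`, then so does one that contains two disjoint
`ℓ`-sets of small codegree. -/
theorem exists_edge_with_light_ends {n k ℓ : ℕ} (hk : 3 ≤ k) (hlk : 2 * ℓ < k)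
    {E : Finset (Finset (Fin n))} (hE : Uniform n k E) {B U Z : Finset (Fin n)} (hBU : B ⊆ U)
    {σ η : ℝ} (hσ : 0 < σ) (hη0 : 0 < η) (hη1 : η ≤ 1)
    (hησ : 9 * (k : ℝ) ^ 2 * (k : ℝ) ^ (2 * k) * (2 ^ k * η) < σ)
    (h0 : (codeg E B ∅ : ℝ) ≤ σ * η ^ ℓ * (n : ℝ) ^ k)
    (hZ : (Z.card : ℝ) ≤ 2 ^ k * η ^ ℓ * n) (hn : 1 ≤ 2 ^ k * η ^ ℓ * n)
    {e₀ : Finset (Fin n)} (he₀ : e₀ ∈ E) (he₀U : e₀ ⊆ U) (he₀Z : Disjoint e₀ Z) :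
    ∃ e ∈ E, e ⊆ U ∧ Disjoint e Z ∧ ∃ M L, M ⊆ e ∧ L ⊆ e ∧ Disjoint M L ∧ M.card = ℓ ∧
      L.card = ℓ ∧ (codeg E B M : ℝ) ≤ σ * (n : ℝ) ^ (k - ℓ) ∧
      (codeg E B L : ℝ) ≤ σ * (n : ℝ) ^ (k - ℓ) := by
  have hn0 : 0 < n := by
    rcases Nat.eq_zero_or_pos n with rfl | h
    · norm_num at hn
    · exact h
  by_cases hall : ∀ M ⊆ e₀, M.card = ℓ → (codeg E B M : ℝ) ≤ σ * (n : ℝ) ^ (k - ℓ)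
  · have hc := hE e₀ he₀
    obtain ⟨M, hM, hMc⟩ := exists_subset_card_eq (show ℓ ≤ e₀.card by omega)
    obtain ⟨L, hL, hLc⟩ := exists_subset_card_eq (show ℓ ≤ (e₀ \ M).card by
      rw [card_sdiff_of_subset hM]; omega)
    exact ⟨e₀, he₀, he₀U, he₀Z, M, L, hM, hL.trans sdiff_subset,
      disjoint_of_subset_right hL disjoint_sdiff, hMc, hLc, hall M hM hMc,
      hall L (hL.trans sdiff_subset) hLc⟩
  push Not at hall
  obtain ⟨M₀, hM₀, hM₀c, hM₀h⟩ := hall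
  obtain ⟨J, hJM, hJmin⟩ := exists_minimal_le_of_wellFoundedLT
    (fun J : Finset (Fin n) => σ * η ^ (ℓ - J.card) * (n : ℝ) ^ (k - J.card) < codeg E B J) M₀
    (by simpa [hM₀c] using hM₀h)
  have hJc : J.card ≤ ℓ := hM₀c ▸ card_le_card hJM
  have hJheavy := hJmin.prop
  have hJne : J.Nonempty := by
    rw [nonempty_iff_ne_empty]
    rintro rfl
    simp only [card_empty, Nat.sub_zero] at hJheavy
    linarith
  obtain ⟨x, hx⟩ := hJne
  set j := J.card with hj
  have hj1 : 1 ≤ j := card_pos.2 ⟨x, hx⟩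
  have hJ₂c : (J.erase x).card = j - 1 := card_erase_of_mem hx
  have hJ₂ : (codeg E B (J.erase x) : ℝ) ≤
      σ * η ^ (ℓ - j + 1) * (n : ℝ) ^ (k - ℓ + (ℓ - j + 1)) := by
    by_contra! h
    rw [show k - ℓ + (ℓ - j + 1) = k - (j - 1) by omega, show ℓ - j + 1 = ℓ - (j - 1) by omega,
      ← hJ₂c] at h
    exact notMem_erase x J (hJmin.2 h (erase_subset _ _) hx)
  have hpow : η ^ ℓ ≤ η ^ (ℓ - j + 1) := pow_le_pow_of_le_one hη0.le hη1 (by omega)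
  have hF₁ := card_heavy_extensions_le hn0 hE B (J.erase x) hσ hJ₂
  have hF₀ := card_heavy_extensions_le (s := ℓ) hn0 hE B ∅ hσ
    (h0.trans (by rw [Nat.sub_add_cancel (by omega)]))
  simp only [empty_union, sdiff_empty] at hF₀
  set F₀ := (powersetCard ℓ B).filter fun T => σ * (n : ℝ) ^ (k - ℓ) < codeg E B T
  set F₁ := (powersetCard (ℓ - j + 1) (B \ J.erase x)).filter fun T =>
    σ * (n : ℝ) ^ (k - ℓ) < codeg E B (J.erase x ∪ T)
  set I₀ : Finset (Fin (k - j)) := univ.filter fun i => 0 ≤ i.val ∧ i.val < ℓ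
  set I₁ : Finset (Fin (k - j)) := univ.filter fun i => ℓ ≤ i.val ∧ i.val < 2 * ℓ - j + 1
  have hI₀ : I₀.card = ℓ := card_filter_val_Ico (by omega)
  have hI₁ : I₁.card = ℓ - j + 1 := (card_filter_val_Ico (by omega)).trans (by omega)
  have hG := codeg_le_card_tuples hE B J
  obtain ⟨g, hgG, hgi, hgZ, hgF⟩ := exists_injective_tuple (η := 2 ^ k * η ^ (ℓ - j + 1))
    (c := σ * η ^ (ℓ - j)) hk (by omega : k - j ≤ 2 * k) _ Z ![I₀, I₁, ∅] ![F₀, F₁, ∅]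
    (by
      intro i
      fin_cases i
      · intro X hX
        have := (mem_powersetCard.1 (mem_filter.1 hX).1).2
        omega
      · intro X hX
        have := (mem_powersetCard.1 (mem_filter.1 hX).1).2
        omega
      · intro X hX
        simp at hX)
    (by
      intro i
      fin_cases i
      · simp only [Fin.zero_eta, Matrix.cons_val_zero, hI₀]
        exact hF₀.trans (by gcongr)
      · simp only [Fin.mk_one, Matrix.cons_val_one, Matrix.cons_val_zero, hI₁]
        exact hF₁
      · simp
        positivity)
    (hZ.trans (by gcongr)) (hn.trans (by gcongr))
    (hJheavy.le.trans (by exact_mod_cast hG))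
    (by
      rw [pow_succ]
      calc _ = (9 * (k : ℝ) ^ 2 * (k : ℝ) ^ (2 * k) * (2 ^ k * η)) * η ^ (ℓ - j) := by ring
        _ < _ := by gcongr)
  rw [mem_filter] at hgG
  obtain ⟨-, hgE, hgB, hgJ⟩ := hgG
  have hgB' : ∀ i, g i ∈ B := fun i => hgB (mem_image_of_mem _ (mem_univ _))
  have hgJ' : ∀ i, g i ∉ J := fun i => disjoint_right.1 hgJ (mem_image_of_mem _ (mem_univ _))
  have hT₀ : I₀.image g ∉ F₀ := hgF 0
  have hT₁ : I₁.image g ∉ F₁ := hgF 1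
  have hsub : ∀ I : Finset (Fin (k - j)), I.image g ⊆ J ∪ univ.image g := fun I =>
    (image_subset_image (subset_univ I)).trans subset_union_right
  have hdJ : ∀ I : Finset (Fin (k - j)), Disjoint J (I.image g) := fun I =>
    disjoint_of_subset_right (image_subset_image (subset_univ I)) hgJ
  have hImB : ∀ I : Finset (Fin (k - j)), I.image g ⊆ B := fun I =>
    (image_subset_image (subset_univ I)).trans hgB
  refine ⟨_, hgE, ?_, ?_, I₀.image g, J.erase x ∪ I₁.image g, hsub _, ?_, ?_, ?_, ?_, ?_, ?_⟩
  · exact union_subset ((hJM.trans hM₀).trans he₀U) (hgB.trans hBU)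
  · rw [disjoint_union_left]
    refine ⟨disjoint_of_subset_left (hJM.trans hM₀) he₀Z, ?_⟩
    rw [disjoint_left]
    intro y hy
    obtain ⟨i, -, rfl⟩ := mem_image.1 hy
    exact hgZ i
  · exact union_subset ((erase_subset _ _).trans subset_union_left) (hsub _)
  · rw [disjoint_union_right]
    refine ⟨(disjoint_of_subset_left (erase_subset _ _) (hdJ _)).symm, ?_⟩
    rw [disjoint_image hgi, disjoint_left]
    intro i hi hi'
    simp only [I₀, I₁, mem_filter] at hi hi'
    omega
  · rw [card_image_of_injective _ hgi, hI₀]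
  · rw [card_union_of_disjoint (disjoint_of_subset_left (erase_subset _ _) (hdJ _)),
      card_image_of_injective _ hgi, hI₁, hJ₂c]
    omega
  · by_contra! h
    apply hT₀
    rw [mem_filter, mem_powersetCard, card_image_of_injective _ hgi, hI₀]
    exact ⟨⟨hImB _, rfl⟩, h⟩
  · by_contra! h
    apply hT₁
    rw [mem_filter, mem_powersetCard, card_image_of_injective _ hgi, hI₁, subset_sdiff]
    exact ⟨⟨⟨hImB _, (disjoint_of_subset_left (erase_subset _ _) (hdJ _)).symm⟩, rfl⟩, h⟩

theorem card_nonedges_add_codeg {n k : ℕ} {E : Finset (Finset (Fin n))}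
    (hE : Uniform n k E) {B : Finset (Fin n)} {a : Fin n} (ha : a ∉ B) :
    ((powersetCard (k - 1) B).filter fun R => insert a R ∉ E).card + codeg E B {a} =
      B.card.choose (k - 1) := by
  rw [← card_powersetCard, add_comm,
    ← card_filter_add_card_filter_not (s := powersetCard (k - 1) B) (fun R => insert a R ∈ E)]
  congr 1
  rw [codeg]
  apply card_bij (fun e _ => e.erase a)
  · intro e he
    simp only [mem_filter, singleton_subset_iff, sdiff_singleton_eq_erase] at he
    rw [mem_filter, mem_powersetCard, insert_erase he.2.1, card_erase_of_mem he.2.1, hE e he.1]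
    exact ⟨⟨he.2.2, rfl⟩, he.1⟩
  · intro e he e' he' h
    simp only [mem_filter, singleton_subset_iff] at he he'
    rw [← insert_erase he.2.1, h, insert_erase he'.2.1]
  · intro R hR
    rw [mem_filter, mem_powersetCard] at hR
    have haR : a ∉ R := fun h => ha (hR.1.1 h)
    refine ⟨insert a R, ?_, erase_insert haR⟩
    simp only [mem_filter, singleton_subset_iff, sdiff_singleton_eq_erase, erase_insert haR]
    exact ⟨hR.2, mem_insert_self _ _, hR.1.1⟩

/-- Few vertices outside `B` fail to form edges with almost all `(k-1)`-subsets of `B`. -/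
theorem card_mul_nonedges_le {n k : ℕ} (hk : 3 ≤ k) {E : Finset (Finset (Fin n))}
    (hE : Uniform n k E) {B : Finset (Fin n)} (hdeg : LargeDegree n k E B)
    (W : Finset (Fin n)) (hW : Disjoint W B) {τ : ℝ}
    (hτ : ∀ a ∈ W, τ ≤ ((powersetCard (k - 1) B).filter fun R => insert a R ∉ E).card) :
    W.card * τ ≤ 2 ^ k * codeg E B ∅ := by
  set N : Fin n → Finset (Finset (Fin n)) := fun a =>
    ((powersetCard (k - 1) B).filter fun R => insert a R ∉ E).image (insert a)
  have hN : ∀ a ∈ W, (N a).card =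
      ((powersetCard (k - 1) B).filter fun R => insert a R ∉ E).card := by
    intro a ha
    apply card_image_of_injOn
    intro R hR R' hR' h
    have haB := disjoint_left.1 hW ha
    simp only [coe_filter, mem_powersetCard, Set.mem_ofPred_eq] at hR hR'
    rw [← erase_insert (fun h => haB (hR.1.1 h)), h, erase_insert (fun h => haB (hR'.1.1 h))]
  have h1 := card_missing_extensions_le hk hE hdeg (M := ∅) (by simp; omega) (W.biUnion N) (by
    intro X hX
    simp only [N, mem_biUnion, mem_image, mem_filter, mem_powersetCard] at hX
    obtain ⟨a, ha, R, ⟨⟨hRB, hRc⟩, hRE⟩, rfl⟩ := hX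
    refine ⟨a, R, disjoint_left.1 hW ha, by simp, by simpa using hRB, ?_, rfl, by simpa using hRE⟩
    rw [card_empty]
    omega)
  rw [card_biUnion] at h1
  · calc W.card * τ = W.card • τ := (nsmul_eq_mul _ _).symm
      _ ≤ ∑ a ∈ W, ((N a).card : ℝ) := card_nsmul_le_sum _ _ _ fun a ha => by
        rw [hN a ha]
        exact hτ a ha
      _ ≤ _ := by exact_mod_cast h1
  · intro a ha a' ha' hne
    rw [Function.onFun, disjoint_left]
    intro X hX hX'
    simp only [N, mem_image, mem_filter, mem_powersetCard] at hX hX'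
    obtain ⟨R, ⟨⟨hRB, -⟩, -⟩, rfl⟩ := hX
    obtain ⟨R', ⟨⟨hRB', -⟩, -⟩, h⟩ := hX'
    have : a ∈ insert a' R' := h ▸ mem_insert_self a R
    rcases mem_insert.1 this with h | h
    · exact hne h
    · exact disjoint_left.1 hW ha (hRB' h)

/-- A set `M` of small codegree can be linked to a light `ℓ`-set by two edges through a single
vertex of `W`. -/
theorem exists_link {n k ℓ d : ℕ} (hk : 3 ≤ k) (hl : 1 ≤ ℓ) (hlk : 2 * ℓ < k) (hd : d = k - ℓ)
    {E : Finset (Finset (Fin n))} (hE : Uniform n k E) {B W M Z : Finset (Fin n)}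
    (hdeg : LargeDegree n k E B) {σ ε : ℝ}
    (hε : 9 * (k : ℝ) ^ 2 * (k : ℝ) ^ (2 * k) * (2 ^ k * ε) < (1 / (8 * (k : ℝ))) ^ (2 * k))
    (hWB : Disjoint W B) (hW : (n : ℝ) ≤ 8 * k * W.card) (hB : (n : ℝ) ≤ 8 * k * B.card)
    (hWE : ∀ a ∈ W,
      (((powersetCard (k - 1) B).filter fun R => insert a R ∉ E).card : ℝ) ≤ ε * (n : ℝ) ^ (k - 1))
    (hheavy : (((powersetCard ℓ B).filter fun T => σ * (n : ℝ) ^ d < codeg E B T).card : ℝ) ≤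
      2 ^ k * ε * (n : ℝ) ^ ℓ)
    (hM : M.card = ℓ) (hMd : (codeg E B M : ℝ) ≤ ε * (n : ℝ) ^ d) (hMZ : M ⊆ Z)
    (hZ : (Z.card : ℝ) ≤ 2 ^ k * ε * n) (hn : 1 ≤ 2 ^ k * ε * n) :
    ∃ g : Fin (2 * d) → Fin n, Function.Injective g ∧ (∀ i, g i ∉ Z) ∧
      (∀ i, g i ∈ if i.val = d then W else B) ∧
      ((univ.filter fun i => i.val < ℓ).image g).card = ℓ ∧
      (codeg E B ((univ.filter fun i => i.val < ℓ).image g) : ℝ) ≤ σ * (n : ℝ) ^ d ∧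
      (univ.filter fun i => i.val < k).image g ∈ E ∧
      M ∪ (univ.filter fun i => d ≤ i.val).image g ∈ E := by
  have hn0 : 0 < n := by
    rcases Nat.eq_zero_or_pos n with rfl | h
    · norm_num at hn
    · exact h
  have hε0 : 0 < ε := by
    by_contra! h
    have : 2 ^ k * ε * n ≤ 0 :=
      mul_nonpos_of_nonpos_of_nonneg (mul_nonpos_of_nonneg_of_nonpos (by positivity) h)
        (Nat.cast_nonneg n)
    linarith
  have hk0 : (1 : ℝ) ≤ k := by exact_mod_cast (by omega : 1 ≤ k)
  set D : Fin (2 * d) → Finset (Fin n) := fun i => if i.val = d then W else B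
  set I₀ : Finset (Fin (2 * d)) := univ.filter fun i => i.val < ℓ
  set I₁ : Finset (Fin (2 * d)) := univ.filter fun i => i.val < k
  set I₂ : Finset (Fin (2 * d)) := univ.filter fun i => d ≤ i.val
  have hI₀ : I₀.card = ℓ := by
    rw [Fin.card_filter_val_lt]
    omega
  have hI₁ : I₁.card = k := by
    rw [Fin.card_filter_val_lt]
    omega
  have hI₂ : I₂.card = d := by
    have : I₂.card = 2 * d - d := by
      rw [← card_filter_val_Ico (r := 2 * d) (a := d) le_rfl]
      congr 1
      ext i
      simp [I₂]
    omega
  set F₀ := (powersetCard ℓ B).filter fun T => σ * (n : ℝ) ^ d < codeg E B T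
  set F₁ := W.biUnion fun a =>
    ((powersetCard (k - 1) B).filter fun R => insert a R ∉ E).image (insert a)
  set F₂ : Finset (Finset (Fin n)) := univ.filter fun X => ∃ a R, a ∉ B ∧ a ∉ M ∧ R ⊆ B \ M ∧
    R.card + 1 + M.card = k ∧ X = insert a R ∧ M ∪ X ∉ E
  have hF₁ : (F₁.card : ℝ) ≤ 2 ^ k * ε * (n : ℝ) ^ k := by
    have h1 : (F₁.card : ℝ) ≤ ∑ a ∈ W, ε * (n : ℝ) ^ (k - 1) := by
      calc (F₁.card : ℝ) ≤ ∑ a ∈ W,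
            ((((powersetCard (k - 1) B).filter fun R => insert a R ∉ E).image (insert a)).card : ℝ)
            := by exact_mod_cast card_biUnion_le
        _ ≤ _ := sum_le_sum fun a ha => le_trans (by exact_mod_cast card_image_le) (hWE a ha)
    rw [sum_const, nsmul_eq_mul] at h1
    have hWn : (W.card : ℝ) ≤ n := by exact_mod_cast (by simpa using card_le_univ W)
    calc (F₁.card : ℝ) ≤ W.card * (ε * (n : ℝ) ^ (k - 1)) := h1
      _ ≤ n * (ε * (n : ℝ) ^ (k - 1)) := by gcongr
      _ = 1 * ε * (n : ℝ) ^ (k - 1 + 1) := by ring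
      _ = 1 * ε * (n : ℝ) ^ k := by rw [Nat.sub_add_cancel (by omega)]
      _ ≤ _ := by
        gcongr
        exact one_le_pow₀ (by norm_num)
  have hF₂ : (F₂.card : ℝ) ≤ 2 ^ k * ε * (n : ℝ) ^ d := by
    have h1 := card_missing_extensions_le hk hE hdeg (M := M) (by omega) F₂ fun X hX =>
      (mem_filter.1 hX).2
    calc (F₂.card : ℝ) ≤ 2 ^ k * codeg E B M := by exact_mod_cast h1
      _ ≤ 2 ^ k * (ε * (n : ℝ) ^ d) := by gcongr
      _ = _ := by ring
  have hG : (1 / (8 * (k : ℝ))) ^ (2 * k) * (n : ℝ) ^ (2 * d) ≤ (Fintype.piFinset D).card := by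
    rw [Fintype.card_piFinset]
    push_cast
    have h1 : ∀ i ∈ (univ : Finset (Fin (2 * d))), 1 / (8 * (k : ℝ)) * n ≤ (D i).card := by
      intro i _
      rw [one_div, inv_mul_le_iff₀ (by positivity)]
      by_cases h : i.val = d
      · simpa only [D, h, if_true] using hW
      · simpa only [D, h, if_false] using hB
    have h2 := prod_le_prod (fun i _ => by positivity) h1
    rw [prod_const, card_univ, Fintype.card_fin, mul_pow] at h2
    refine le_trans ?_ h2
    refine mul_le_mul_of_nonneg_right
      (pow_le_pow_of_le_one (by positivity) ?_ (by omega)) (by positivity)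
    rw [div_le_one (by positivity)]
    linarith
  obtain ⟨g, hgD, hgi, hgZ, hgF⟩ := exists_injective_tuple (η := 2 ^ k * ε) hk
    (by omega : 2 * d ≤ 2 * k) (Fintype.piFinset D) Z ![I₀, I₁, I₂] ![F₀, F₁, F₂]
    (by
      intro i
      fin_cases i
      · intro X hX
        have := (mem_powersetCard.1 (mem_filter.1 hX).1).2
        omega
      · intro X hX
        simp only [F₁, Fin.mk_one, Matrix.cons_val_one, Matrix.cons_val_zero, mem_biUnion,
          mem_image, mem_filter, mem_powersetCard] at hX
        obtain ⟨a, -, R, hR, rfl⟩ := hX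
        have := card_insert_le a R
        omega
      · intro X hX
        obtain ⟨-, a, R, -, -, -, hR, rfl, -⟩ := mem_filter.1 hX
        have := card_insert_le a R
        omega)
    (by
      intro i
      fin_cases i
      · simpa [hI₀] using hheavy
      · simpa [hI₁] using hF₁
      · simpa [hI₂] using hF₂)
    hZ hn hG hε
  rw [Fintype.mem_piFinset] at hgD
  have hT₀ : I₀.image g ∉ F₀ := hgF 0
  have hT₁ : I₁.image g ∉ F₁ := hgF 1
  have hT₂ : I₂.image g ∉ F₂ := hgF 2
  have hgB : ∀ i : Fin (2 * d), i.val ≠ d → g i ∈ B := fun i hi => by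
    have := hgD i
    rwa [show D i = B from if_neg hi] at this
  set i₀ : Fin (2 * d) := ⟨d, by omega⟩
  have hgW : g i₀ ∈ W := by
    have := hgD i₀
    rwa [show D i₀ = W from if_pos rfl] at this
  have hsplit : ∀ I : Finset (Fin (2 * d)), i₀ ∈ I →
      I.image g = insert (g i₀) ((I.erase i₀).image g) := fun I hI => by
    rw [← image_insert, insert_erase hI]
  have hrest : ∀ I : Finset (Fin (2 * d)), (I.erase i₀).image g ⊆ B := fun I => by
    rw [image_subset_iff]
    intro i hi
    apply hgB i
    intro h
    exact ne_of_mem_erase hi (Fin.ext h)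
  have hi₁ : i₀ ∈ I₁ := mem_filter.2 ⟨mem_univ _, by change d < k; omega⟩
  have hi₂ : i₀ ∈ I₂ := mem_filter.2 ⟨mem_univ _, le_rfl⟩
  have hgM : ∀ i, g i ∉ M := fun i h => hgZ i (hMZ h)
  have hc₀ : (I₀.image g).card = ℓ := by rw [card_image_of_injective _ hgi, hI₀]
  refine ⟨g, hgi, hgZ, hgD, hc₀, ?_, ?_, ?_⟩
  · by_contra! h
    apply hT₀
    rw [mem_filter, mem_powersetCard]
    refine ⟨⟨?_, hc₀⟩, h⟩
    rw [image_subset_iff]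
    intro i hi
    apply hgB
    have := (mem_filter.1 hi).2
    omega
  · by_contra h
    apply hT₁
    rw [hsplit _ hi₁] at h ⊢
    simp only [F₁, mem_biUnion]
    refine ⟨_, hgW, mem_image_of_mem _ ?_⟩
    rw [mem_filter, mem_powersetCard, card_image_of_injective _ hgi, card_erase_of_mem hi₁, hI₁]
    exact ⟨⟨hrest _, rfl⟩, h⟩
  · by_contra h
    apply hT₂
    refine mem_filter.2 ⟨mem_univ _, g i₀, (I₂.erase i₀).image g, disjoint_left.1 hWB hgW,
      hgM _, ?_, ?_, hsplit _ hi₂, h⟩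
    · rw [subset_sdiff]
      refine ⟨hrest _, ?_⟩
      rw [disjoint_left]
      intro y hy
      obtain ⟨i, -, rfl⟩ := mem_image.1 hy
      exact hgM i
    · rw [card_image_of_injective _ hgi, card_erase_of_mem hi₂, hI₂, hM]
      omega

theorem mul_add_choose_two_le (m q : ℕ) : q * m + m.choose 2 ≤ (m + q).choose 2 := by
  induction q with
  | zero => simp
  | succ q ih =>
    have h : (m + (q + 1)).choose 2 = (m + q).choose 1 + (m + q).choose 2 :=
      Nat.choose_succ_succ _ _
    rw [h, Nat.choose_one_right]
    nlinarith

theorem mul_le_card_edges_within {n k q : ℕ} (hk : 3 ≤ k) {E : Finset (Finset (Fin n))}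
    (hE : Uniform n k E) {B U : Finset (Fin n)} (hdeg : LargeDegree n k E B)
    (hkB : k ≤ B.card) (hU : U.card = B.card + q) {S : Finset (Fin n)} (hSU : S ⊆ U)
    (hS : S.card = k - 2) :
    q * (B.card - (k - 2)) ≤ ((E.filter fun e => e ⊆ U).filter fun e => S ⊆ e).card := by
  have h1 := hdeg S hS
  have h2 := card_filter_powersetCard_subset S univ k (subset_univ S) (by omega)
  have h3 := card_filter_powersetCard_subset S U k hSU (by omega)
  rw [card_univ, Fintype.card_fin, hS, show k - (k - 2) = 2 by omega] at h2
  rw [hS, hU, show k - (k - 2) = 2 by omega,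
    show B.card + q - (k - 2) = B.card - (k - 2) + q by omega] at h3
  have h4 := mul_add_choose_two_le (B.card - (k - 2)) q
  set P := (E.filter fun e => ¬ e ⊆ U).filter fun e => S ⊆ e
  set Q := (powersetCard k U).filter fun e => S ⊆ e
  have h5 : deg E S ≤ ((E.filter fun e => e ⊆ U).filter fun e => S ⊆ e).card + P.card := by
    refine (card_le_card ?_).trans (card_union_le _ _)
    intro e he
    simp only [P, mem_union, mem_filter] at he ⊢
    tauto
  have h6 : P.card + Q.card ≤ (n - (k - 2)).choose 2 := by
    rw [← h2, ← card_union_of_disjoint]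
    · apply card_le_card
      intro e he
      simp only [P, Q, mem_union, mem_filter, mem_powersetCard, subset_univ, true_and] at he ⊢
      rcases he with he | he
      · exact ⟨hE e he.1.1, he.2⟩
      · exact ⟨he.1.2, he.2⟩
    · rw [disjoint_left]
      intro e he he'
      simp only [P, Q, mem_filter, mem_powersetCard] at he he'
      exact he.1.2 he'.1.1
  omega

theorem card_edges_within_le {n k : ℕ} (hk : 2 ≤ k) {E : Finset (Finset (Fin n))}
    (hE : Uniform n k E) (B U : Finset (Fin n)) (z : Fin n) :
    ((E.filter fun e => e ⊆ U).filter fun e => z ∈ e).card ≤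
      codeg E B {z} + (U \ B).card * n ^ (k - 2) := by
  set P : Fin n → Finset (Finset (Fin n)) := fun y =>
    (powersetCard k univ).filter fun e => {z, y} ⊆ e
  have h1 : ((U \ B).erase z).card * n ^ (k - 2) ≤ (U \ B).card * n ^ (k - 2) :=
    Nat.mul_le_mul_right _ (card_erase_le)
  refine le_trans ?_ (Nat.add_le_add_left h1 _)
  have h2 : (((U \ B).erase z).biUnion P).card ≤ ((U \ B).erase z).card * n ^ (k - 2) := by
    apply card_biUnion_le_card_mul
    intro y hy
    have hc : ({z, y} : Finset (Fin n)).card = 2 := card_pair (ne_of_mem_erase hy).symm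
    simp only [P]
    rw [card_filter_powersetCard_subset _ _ _ (subset_univ _) (by omega), hc, card_univ,
      Fintype.card_fin]
    exact (Nat.choose_le_pow _ _).trans (Nat.pow_le_pow_left (Nat.sub_le _ _) _)
  refine le_trans ?_ (Nat.add_le_add_left h2 _)
  refine (card_le_card ?_).trans (card_union_le _ _)
  intro e he
  simp only [mem_filter] at he
  simp only [P, mem_union, mem_filter, mem_biUnion, singleton_subset_iff, mem_powersetCard,
    subset_univ, true_and, sdiff_singleton_eq_erase]
  by_cases h : e.erase z ⊆ B
  · exact Or.inl ⟨he.1.1, he.2, h⟩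
  · right
    rw [not_subset] at h
    obtain ⟨y, hy, hyB⟩ := h
    rw [mem_erase] at hy
    refine ⟨y, by simp [hy.1, hyB, he.1.2 hy.2], hE e he.1.1, ?_⟩
    rw [insert_subset_iff, singleton_subset_iff]
    exact ⟨he.2, hy.2⟩

/-- Every small set is avoided by some edge inside `U`. -/
theorem exists_edge_within_disjoint {n k q : ℕ} (hk : 3 ≤ k) (hn : 4 * k ≤ n) (hq : 1 ≤ q)
    {E : Finset (Finset (Fin n))} (hE : Uniform n k E) {B U Z : Finset (Fin n)}
    (hdeg : LargeDegree n k E B) (hBU : B ⊆ U) (hU : U.card = B.card + q)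
    (hB : n ≤ 2 * B.card) {ε ζ : ℝ} (hUε : ∀ z ∈ U, (codeg E B {z} : ℝ) ≤ ε * (n : ℝ) ^ (k - 1))
    (hqζ : (q : ℝ) ≤ ζ * n) (hZ : Z.card ≤ 16 * k * q)
    (hεζ : 2 ^ k * (16 * k * (ε + ζ)) < ((4 : ℝ) ^ k * (k.factorial : ℝ))⁻¹ / 4) :
    ∃ e ∈ E, e ⊆ U ∧ Disjoint e Z := by
  by_contra! hcon
  set G := E.filter fun e => e ⊆ U
  have hn' : (0 : ℝ) < n := by exact_mod_cast (by omega : 0 < n)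
  have hq' : (0 : ℝ) < q := by exact_mod_cast hq
  have hlow : B.card.choose (k - 2) * (q * (B.card - (k - 2))) ≤ 2 ^ k * G.card := by
    calc _ = ∑ S ∈ powersetCard (k - 2) B, q * (B.card - (k - 2)) := by
          rw [sum_const, card_powersetCard, smul_eq_mul]
      _ ≤ ∑ S ∈ powersetCard (k - 2) B, (G.filter fun e => S ⊆ e).card :=
          sum_le_sum fun S hS => mul_le_card_edges_within hk hE hdeg (by omega) hU
            ((mem_powersetCard.1 hS).1.trans hBU) (mem_powersetCard.1 hS).2
      _ = ∑ e ∈ G, ((powersetCard (k - 2) B).filter fun S => S ⊆ e).card := by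
          simp_rw [card_filter]
          rw [sum_comm]
      _ ≤ ∑ e ∈ G, 2 ^ k := by
          apply sum_le_sum
          intro e he
          rw [← hE e (mem_filter.1 he).1, ← card_powerset]
          apply card_le_card
          intro S hS
          exact mem_powerset.2 (mem_filter.1 hS).2
      _ = 2 ^ k * G.card := by rw [sum_const, smul_eq_mul, mul_comm]
  have hUB : (U \ B).card = q := by
    rw [card_sdiff_of_subset hBU]
    omega
  have hup : (G.card : ℝ) ≤ 16 * k * q * ((ε + ζ) * (n : ℝ) ^ (k - 1)) := by
    have h1 : G ⊆ (Z ∩ U).biUnion fun z => G.filter fun e => z ∈ e := by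
      intro e he
      have h2 := hcon e (mem_filter.1 he).1 (mem_filter.1 he).2
      rw [not_disjoint_iff] at h2
      obtain ⟨z, hze, hzZ⟩ := h2
      rw [mem_biUnion]
      exact ⟨z, mem_inter.2 ⟨hzZ, (mem_filter.1 he).2 hze⟩, mem_filter.2 ⟨he, hze⟩⟩
    have h3 : ∀ z ∈ Z ∩ U, ((G.filter fun e => z ∈ e).card : ℝ) ≤ (ε + ζ) * (n : ℝ) ^ (k - 1) := by
      intro z hz
      have h4 := card_edges_within_le (by omega) hE B U z
      rw [hUB] at h4
      calc ((G.filter fun e => z ∈ e).card : ℝ) ≤ codeg E B {z} + q * (n : ℝ) ^ (k - 2) := by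
            exact_mod_cast h4
        _ ≤ ε * (n : ℝ) ^ (k - 1) + ζ * n * (n : ℝ) ^ (k - 2) := by
            gcongr
            exact hUε z (mem_inter.1 hz).2
        _ = ε * (n : ℝ) ^ (k - 1) + ζ * (n : ℝ) ^ (k - 2 + 1) := by ring
        _ = _ := by
          rw [show k - 2 + 1 = k - 1 by omega]
          ring
    have h5 : 0 ≤ (ε + ζ) * (n : ℝ) ^ (k - 1) := by
      by_contra! h
      have hZU : ((Z ∩ U).card : ℝ) • ((ε + ζ) * (n : ℝ) ^ (k - 1)) ≤ 0 :=
        mul_nonpos_of_nonneg_of_nonpos (Nat.cast_nonneg _) h.le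
      have h6 : Z ∩ U = ∅ := by
        rw [eq_empty_iff_forall_notMem]
        intro z hz
        have h7 := h3 z hz
        have h8 : (0 : ℝ) ≤ ((G.filter fun e => z ∈ e).card : ℝ) := Nat.cast_nonneg _
        linarith
      rw [h6, biUnion_empty, subset_empty] at h1
      rw [h1, card_empty, mul_zero] at hlow
      have h9 := Nat.choose_pos (show k - 2 ≤ B.card by omega)
      have h10 : 0 < q * (B.card - (k - 2)) := Nat.mul_pos hq (by omega)
      exact absurd hlow (not_le.2 (Nat.mul_pos h9 h10))
    calc (G.card : ℝ) ≤ ∑ z ∈ Z ∩ U, ((G.filter fun e => z ∈ e).card : ℝ) := by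
          exact_mod_cast (card_le_card h1).trans card_biUnion_le
      _ ≤ (Z ∩ U).card • ((ε + ζ) * (n : ℝ) ^ (k - 1)) := sum_le_card_nsmul _ _ _ h3
      _ = (Z ∩ U).card * ((ε + ζ) * (n : ℝ) ^ (k - 1)) := nsmul_eq_mul _ _
      _ ≤ _ := by
        gcongr
        exact_mod_cast (card_le_card inter_subset_left).trans hZ
  have hlow' : ((4 : ℝ) ^ k * (k.factorial : ℝ))⁻¹ * (n : ℝ) ^ (k - 2) * (q * (n / 4)) ≤
      2 ^ k * G.card := by
    have h1 : (n : ℝ) ≤ 4 * ((B.card - (k - 2) : ℕ) : ℝ) := by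
      exact_mod_cast (show n ≤ 4 * (B.card - (k - 2)) by omega)
    calc _ ≤ (B.card.choose (k - 2) : ℝ) * (q * ((B.card - (k - 2) : ℕ) : ℝ)) := by
          gcongr
          · exact pow_le_choose_of_le (by omega) hn hB
          · linarith
      _ ≤ _ := by exact_mod_cast hlow
  have hpow : (n : ℝ) ^ (k - 1) = (n : ℝ) ^ (k - 2) * n := by
    rw [← pow_succ, show k - 2 + 1 = k - 1 by omega]
  have hX : (0 : ℝ) < q * ((n : ℝ) ^ (k - 2) * n) := by positivity
  rw [hpow] at hup
  have h2 : 2 ^ k * (16 * k * (ε + ζ)) * (q * ((n : ℝ) ^ (k - 2) * n)) <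
      ((4 : ℝ) ^ k * (k.factorial : ℝ))⁻¹ / 4 * (q * ((n : ℝ) ^ (k - 2) * n)) :=
    mul_lt_mul_of_pos_right hεζ hX
  have h3 : (2 : ℝ) ^ k * G.card ≤
      2 ^ k * (16 * k * q * ((ε + ζ) * ((n : ℝ) ^ (k - 2) * n))) := by gcongr
  nlinarith

/-- Any small set is avoided by a path of size three that meets `W` in a single vertex and whose
ends are light. -/
theorem exists_path_disjoint {n k ℓ q : ℕ} (hk : 3 ≤ k) (hl : 1 ≤ ℓ) (hlk : 2 * ℓ < k)
    (hq : 1 ≤ q) {E : Finset (Finset (Fin n))} (hE : Uniform n k E) {B U W Z : Finset (Fin n)}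
    (hdeg : LargeDegree n k E B) (hBU : B ⊆ U) (hU : U.card = B.card + q) (hWU : Disjoint W U)
    (hB : n ≤ 2 * B.card) (hW : (n : ℝ) ≤ 8 * k * W.card) {σ ε η ζ : ℝ} (hσ : 0 < σ)
    (hσε : σ ≤ ε) (hη0 : 0 < η) (hη1 : η ≤ 1) (hηε : η ≤ ε)
    (hησ : 9 * (k : ℝ) ^ 2 * (k : ℝ) ^ (2 * k) * (2 ^ k * η) < σ)
    (hε : 9 * (k : ℝ) ^ 2 * (k : ℝ) ^ (2 * k) * (2 ^ k * ε) < (1 / (8 * (k : ℝ))) ^ (2 * k))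
    (hεζ : 2 ^ k * (16 * k * (ε + ζ)) < ((4 : ℝ) ^ k * (k.factorial : ℝ))⁻¹ / 4)
    (hζη : 16 * k * ζ ≤ η ^ ℓ) (hζ : k ≤ ζ * n)
    (h0 : (codeg E B ∅ : ℝ) ≤ σ * η ^ ℓ * (n : ℝ) ^ k)
    (hUε : ∀ z ∈ U, (codeg E B {z} : ℝ) ≤ ε * (n : ℝ) ^ (k - 1))
    (hWE : ∀ a ∈ W,
      (((powersetCard (k - 1) B).filter fun R => insert a R ∉ E).card : ℝ) ≤ ε * (n : ℝ) ^ (k - 1))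
    (hqζ : (q : ℝ) ≤ ζ * n) (hZ : Z.card ≤ 16 * k * q) :
    ∃ f : ℕ → Fin n, IsPath n k ℓ 3 E f ∧ Disjoint (pathVerts n k ℓ 3 f) Z ∧
      (pathVerts n k ℓ 3 f ∩ W).card = 1 ∧
      ((pathEnd0 n ℓ f).card = ℓ ∧ pathEnd0 n ℓ f ⊆ U ∧
        (codeg E B (pathEnd0 n ℓ f) : ℝ) ≤ σ * (n : ℝ) ^ (k - ℓ)) ∧
      ((pathEnd1 n k ℓ 3 f).card = ℓ ∧ pathEnd1 n k ℓ 3 f ⊆ U ∧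
        (codeg E B (pathEnd1 n k ℓ 3 f) : ℝ) ≤ σ * (n : ℝ) ^ (k - ℓ)) := by
  have hk0 : (3 : ℝ) ≤ k := by exact_mod_cast hk
  have hn0 : (0 : ℝ) ≤ n := Nat.cast_nonneg n
  have hε0 : 0 < ε := hσ.trans_le hσε
  have h2k : (2 : ℝ) ≤ 2 ^ k := le_self_pow₀ (by norm_num) (by omega)
  have hηℓ : η ^ ℓ ≤ ε := (pow_le_of_le_one hη0.le hη1 (by omega)).trans hηε
  have hζn : 16 * k * (ζ * n) ≤ η ^ ℓ * n := by
    rw [← mul_assoc]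
    exact mul_le_mul_of_nonneg_right hζη hn0
  have hkη : 16 * k * (k : ℝ) ≤ η ^ ℓ * n :=
    (mul_le_mul_of_nonneg_left hζ (by positivity)).trans hζn
  have hkη' : (k : ℝ) ≤ η ^ ℓ * n := by nlinarith
  have hηn : η ^ ℓ * n ≤ ε * n := mul_le_mul_of_nonneg_right hηℓ hn0
  have h2η : η ^ ℓ * n ≤ 2 ^ k * η ^ ℓ * n := by
    rw [mul_assoc]
    exact le_mul_of_one_le_left (by positivity) (by linarith)
  have hn4 : 4 * k ≤ n := by
    have h1 : η ^ ℓ * n ≤ n := mul_le_of_le_one_left hn0 (pow_le_one₀ hη0.le hη1)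
    have h2 : (4 : ℝ) * k ≤ n := by nlinarith
    exact_mod_cast h2
  have hZη : (Z.card : ℝ) ≤ η ^ ℓ * n := by
    calc (Z.card : ℝ) ≤ 16 * k * q := by exact_mod_cast hZ
      _ ≤ 16 * k * (ζ * n) := by gcongr
      _ ≤ _ := hζn
  obtain ⟨e₀, he₀, he₀U, he₀Z⟩ :=
    exists_edge_within_disjoint hk hn4 hq hE hdeg hBU hU hB hUε hqζ hZ hεζ
  obtain ⟨e, he, heU, heZ, M, L, hMe, hLe, hML, hMc, hLc, hMd, hLd⟩ :=
    exists_edge_with_light_ends hk hlk hE hBU hσ hη0 hη1 hησ h0 (hZη.trans h2η)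
      (by linarith) he₀ he₀U he₀Z
  have hec := hE e he
  have hheavy := card_heavy_extensions_le (s := ℓ) (η := ε) (σ := σ) (by omega : 0 < n) hE B ∅ hσ
    (by
      rw [Nat.sub_add_cancel (by omega)]
      refine h0.trans ?_
      gcongr)
  simp only [sdiff_empty, empty_union] at hheavy
  obtain ⟨g, hgi, hgZ, hgD, hg0, hg0d, hgE, hgME⟩ := exists_link (Z := Z ∪ e) hk hl hlk rfl hE hdeg
    hε (hWU.mono_right hBU) hW (by
      calc (n : ℝ) ≤ 2 * B.card := by exact_mod_cast hB
        _ ≤ 8 * k * B.card := by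
          gcongr
          linarith) hWE hheavy hMc
    (hMd.trans (by gcongr)) (hMe.trans subset_union_right)
    (by
      calc ((Z ∪ e).card : ℝ) ≤ Z.card + e.card := by exact_mod_cast card_union_le _ _
        _ ≤ ε * n + ε * n := by
          rw [hec]
          linarith
        _ = 2 * (ε * n) := by ring
        _ ≤ 2 ^ k * (ε * n) := by gcongr
        _ = _ := by ring)
    (by nlinarith)
  obtain ⟨f, hf, hfv, hf0, hf1⟩ := exists_path hlk rfl g hgi hec he hMe hLe hML hMc hLc
    (fun i h => hgZ i (mem_union_right _ h)) hgE hgME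
  have hgB : ∀ i : Fin (2 * (k - ℓ)), i.val ≠ k - ℓ → g i ∈ B := fun i hi => by
    simpa only [hi, if_false] using hgD i
  refine ⟨f, hf, ?_, ?_, ?_, ?_⟩
  · rw [hfv, disjoint_union_left]
    refine ⟨?_, heZ⟩
    rw [disjoint_left]
    intro y hy
    obtain ⟨i, -, rfl⟩ := mem_image.1 hy
    exact fun h => hgZ i (mem_union_left _ h)
  · set i₀ : Fin (2 * (k - ℓ)) := ⟨k - ℓ, by omega⟩
    have hgW : g i₀ ∈ W := by simpa only [i₀, if_true] using hgD i₀
    rw [card_eq_one, hfv]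
    refine ⟨g i₀, eq_singleton_iff_unique_mem.2 ⟨?_, ?_⟩⟩
    · exact mem_inter.2 ⟨mem_union_left _ (mem_image_of_mem _ (mem_univ _)), hgW⟩
    · intro y hy
      rw [mem_inter, mem_union] at hy
      obtain ⟨hy | hy, hyW⟩ := hy
      · obtain ⟨i, -, rfl⟩ := mem_image.1 hy
        by_contra hne
        exact disjoint_left.1 hWU hyW (hBU (hgB i fun h => hne (congrArg g (Fin.ext h))))
      · exact absurd (heU hy) (disjoint_left.1 hWU hyW)
  · rw [hf0]
    refine ⟨hg0, ?_, hg0d⟩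
    rw [image_subset_iff]
    intro i hi
    have := (mem_filter.1 hi).2
    exact hBU (hgB i (by omega))
  · rw [hf1]
    exact ⟨hLc, hLe.trans heU, hLd⟩

/-- A choice of sufficiently small parameters. -/
theorem exists_parameters (k ℓ : ℕ) (hk : 3 ≤ k) :
    ∃ ε η ζ : ℝ, 0 < ε ∧ ε < 1 / 2 ∧ 0 < η ∧ η ≤ 1 ∧ η ≤ ε ∧ 0 < ζ ∧ 16 * k * ζ ≤ η ^ ℓ ∧
      9 * (k : ℝ) ^ 2 * (k : ℝ) ^ (2 * k) * (2 ^ k * η) <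
        ε * ((4 : ℝ) ^ k * (k.factorial : ℝ))⁻¹ ∧
      9 * (k : ℝ) ^ 2 * (k : ℝ) ^ (2 * k) * (2 ^ k * ε) < (1 / (8 * (k : ℝ))) ^ (2 * k) ∧
      2 ^ k * (16 * k * (ε + ζ)) < ((4 : ℝ) ^ k * (k.factorial : ℝ))⁻¹ / 4 := by
  have hk0 : (3 : ℝ) ≤ k := by exact_mod_cast hk
  set κ : ℝ := ((4 : ℝ) ^ k * (k.factorial : ℝ))⁻¹
  have hκ : 0 < κ := by positivity
  set C : ℝ := 9 * (k : ℝ) ^ 2 * (k : ℝ) ^ (2 * k) * 2 ^ k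
  have hC : 0 < C := by positivity
  set D : ℝ := 2 ^ k * (16 * k * 2)
  have hD : 0 < D := by positivity
  obtain ⟨ε, hε, h⟩ := exists_pos_mul_lt
    (show 0 < min (1 / 2) (min ((1 / (8 * (k : ℝ))) ^ (2 * k)) (κ / 4)) by positivity) (1 + C + D)
  rw [lt_min_iff, lt_min_iff] at h
  obtain ⟨η, hη, h'⟩ := exists_pos_mul_lt (show 0 < min 1 (min ε (ε * κ)) by positivity) (1 + C)
  rw [lt_min_iff, lt_min_iff] at h'
  have hCε : 0 < C * ε := mul_pos hC hε
  have hDε : 0 < D * ε := mul_pos hD hε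
  have hCη : 0 < C * η := mul_pos hC hη
  have hζ : 0 < min ε (η ^ ℓ / (16 * k)) := by positivity
  refine ⟨ε, η, min ε (η ^ ℓ / (16 * k)), hε, by linarith, hη, by linarith, by linarith, hζ, ?_,
    ?_, ?_, ?_⟩
  · rw [← le_div_iff₀' (by positivity)]
    exact min_le_right _ _
  · rw [← mul_assoc]
    change C * η < _
    linarith
  · rw [← mul_assoc]
    change C * ε < _
    linarith
  · calc 2 ^ k * (16 * k * (ε + min ε (η ^ ℓ / (16 * k)))) ≤ 2 ^ k * (16 * k * (ε + ε)) := by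
          gcongr
          exact min_le_left _ _
      _ = D * ε := by
        simp only [D]
        ring
      _ < _ := by linarith

/-- Lemma: 2q+2 paths. For all integers `k ≥ 3` and `1 ≤ ℓ < k/2`
there exist `ε, θ, ξ > 0` and `n₀` such that in the usual extremal setup, if
`q = |A ∩ B_ε| > 0` then there exist `2q+2` vertex-disjoint ℓ-paths of size three in
`H`, each containing exactly one vertex of `A_ε` and having two ε-typical ℓ-sets as
ends. -/
theorem statement10 (k ℓ : ℕ) (hk : 3 ≤ k) (hl : 1 ≤ ℓ) (hlk : 2 * ℓ < k) :
    ∃ ε θ ξ : ℝ, 0 < ε ∧ 0 < θ ∧ 0 < ξ ∧ ∃ n₀ : ℕ, ∀ n : ℕ, n₀ ≤ n → (k - ℓ) ∣ n →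
      ∀ E : Finset (Finset (Fin n)), Uniform n k E →
        ∀ A B : Finset (Fin n), IsMinExtremalPartition n k ℓ E ξ A B →
          minDeg n (Xedges n k ℓ) (k - 2) < minDeg n E (k - 2) →
          0 < (A ∩ Beps n k E B ε).card →
          ∃ F : Fin (2 * (A ∩ Beps n k E B ε).card + 2) → ℕ → Fin n,
            (∀ i, IsPath n k ℓ 3 E (F i)) ∧
            (∀ i j, i ≠ j →
              Disjoint (pathVerts n k ℓ 3 (F i)) (pathVerts n k ℓ 3 (F j))) ∧
            (∀ i, (pathVerts n k ℓ 3 (F i) ∩ Aeps n k E B ε).card = 1) ∧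
            (∀ i, IsTypical n k ℓ E B ε (pathEnd0 n ℓ (F i)) ∧
              IsTypical n k ℓ E B ε (pathEnd1 n k ℓ 3 (F i))) := by
  obtain ⟨ε, η, ζ, hε0, hε2, hη0, hη1, hηε, hζ0, hζη, hησ, hε, hεζ⟩ := exists_parameters k ℓ hk
  set κ : ℝ := ((4 : ℝ) ^ k * (k.factorial : ℝ))⁻¹ with hκdef
  have hκ0 : 0 < κ := by positivity
  have hκ1 : κ ≤ 1 := inv_le_one_of_one_le₀ (one_le_mul_of_one_le_of_one_le
    (one_le_pow₀ (by norm_num)) (by exact_mod_cast k.factorial_pos))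
  set σ := ε * κ
  have hσ0 : 0 < σ := mul_pos hε0 hκ0
  have hσε : σ ≤ ε := mul_le_of_le_one_right hε0.le hκ1
  have hk0 : (3 : ℝ) ≤ k := by exact_mod_cast hk
  have hηℓ : η ^ ℓ ≤ 1 := pow_le_one₀ hη0.le hη1
  have hξ : 0 < ζ * σ / 2 ^ k := by positivity
  refine ⟨ε, 1, ζ * σ / 2 ^ k, hε0, one_pos, hξ, ⌈k / ζ⌉₊, ?_⟩
  intro n hn hdn E hE A B hAB hdegX hq
  have hζ : (k : ℝ) ≤ ζ * n := by
    rw [← div_le_iff₀' hζ0]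
    exact Nat.ceil_le.1 hn
  have hζn : 16 * k * (ζ * n) ≤ n := by
    rw [← mul_assoc]
    exact mul_le_of_le_one_left (Nat.cast_nonneg n) (hζη.trans hηℓ)
  have hkn : 16 * (k * k) ≤ n := by
    have : (16 * (k * k) : ℝ) ≤ n := by
      linarith [mul_le_mul_of_nonneg_left hζ (show (0 : ℝ) ≤ 16 * k by positivity)]
    exact_mod_cast this
  have hn4 : 4 * k ≤ n := by linarith [Nat.le_mul_self k]
  have hn0 : (0 : ℝ) < n := by exact_mod_cast (by omega : 0 < n)
  obtain ⟨⟨hdisj, huniv, hAc, -, hξE⟩, -⟩ := id hAB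
  rw [ceil_div_two_mul (by omega) hdn] at hAc
  have hABn : A.card + B.card = n := by
    rw [← card_union_of_disjoint hdisj, huniv, card_univ, Fintype.card_fin]
  have hdeg : LargeDegree n k E B := largeDegree_of_minDeg_lt hk (by omega) (by omega) hdegX
  have hm : n / (k - ℓ) * (k - ℓ) = n := Nat.div_mul_cancel hdn
  have hB : n ≤ 2 * B.card := by
    have := Nat.div_le_self n (k - ℓ)
    omega
  have hA : n ≤ 2 * k * (A.card + 1) := by
    calc n = n / (k - ℓ) * (k - ℓ) := hm.symm
      _ ≤ (2 * (A.card + 1)) * k := Nat.mul_le_mul (by omega) (by omega)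
      _ = _ := by ring
  set U := Beps n k E B ε with hUdef
  set W := Aeps n k E B ε with hWdef
  set C : ℝ := (B.card.choose (k - 1) : ℝ) with hC
  have hCn : κ * (n : ℝ) ^ (k - 1) ≤ C := pow_le_choose_of_le (by omega) hn4 hB
  have hCn' : C ≤ (n : ℝ) ^ (k - 1) := choose_cast_le_pow (by omega)
  have hC0 : 0 < C := lt_of_lt_of_le (by positivity) hCn
  have hmemU : ∀ v, v ∈ U ↔ (codeg E B {v} : ℝ) ≤ ε * C := fun v => mem_Beps (by omega) hE
  have hmemW : ∀ v, v ∈ W ↔ (1 - ε) * C ≤ codeg E B {v} := fun v => mem_Aeps (by omega) hE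
  have hWU : Disjoint W U := by
    rw [disjoint_left]
    intro v hvW hvU
    rw [hmemW] at hvW
    rw [hmemU] at hvU
    linarith [mul_pos (show 0 < 1 - 2 * ε by linarith) hC0]
  have hBU : B ⊆ U := subset_Beps_of_minimal (by omega) hE hAB (card_pos.1 hq)
  have hWB : Disjoint W B := hWU.mono_right hBU
  have hA_of : ∀ v, v ∉ B → v ∈ A := fun v hv => by
    have : v ∈ A ∪ B := huniv ▸ mem_univ v
    exact (mem_union.1 this).resolve_right hv
  set q := (A ∩ U).card with hqdef
  have hU : U.card = B.card + q := by
    rw [hqdef, ← card_union_of_disjoint (hdisj.symm.mono_right inter_subset_left),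
      union_inter_distrib_left, union_comm B A, huniv, univ_inter, union_eq_right.2 hBU]
  have hcod : ∀ a, a ∉ B →
      (((powersetCard (k - 1) B).filter fun R => insert a R ∉ E).card : ℝ) + codeg E B {a} = C :=
    fun a ha => by
      rw [hC]
      exact_mod_cast card_nonedges_add_codeg hE ha
  have h0' : (codeg E B ∅ : ℝ) ≤ ζ * σ / 2 ^ k * (n : ℝ) ^ k := by
    have : codeg E B ∅ = edgesIn E B := by simp [codeg, edgesIn]
    rw [this]
    refine hξE.trans ?_
    gcongr
    exact choose_cast_le_pow le_rfl
  have h0 : (codeg E B ∅ : ℝ) ≤ σ * η ^ ℓ * (n : ℝ) ^ k := by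
    refine h0'.trans ?_
    gcongr
    rw [mul_comm ζ]
    refine (div_le_self (by positivity) (one_le_pow₀ (by norm_num))).trans ?_
    gcongr
    exact (le_mul_of_one_le_left hζ0.le (by linarith)).trans hζη
  have hAW : ((A \ W).card : ℝ) ≤ ζ * n := by
    have h1 := card_mul_nonedges_le hk hE hdeg (A \ W) (hdisj.mono_left sdiff_subset)
      (τ := σ * (n : ℝ) ^ (k - 1)) (by
        intro a ha
        rw [mem_sdiff, hmemW, not_le] at ha
        have h2 := hcod a (disjoint_left.1 hdisj ha.1)
        have h3 : ε * (κ * (n : ℝ) ^ (k - 1)) ≤ ε * C := mul_le_mul_of_nonneg_left hCn hε0.le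
        rw [← mul_assoc] at h3
        linarith)
    have h4 : 2 ^ k * (codeg E B ∅ : ℝ) ≤ ζ * n * (σ * (n : ℝ) ^ (k - 1)) := by
      calc 2 ^ k * (codeg E B ∅ : ℝ) ≤ 2 ^ k * (ζ * σ / 2 ^ k * (n : ℝ) ^ k) := by gcongr
        _ = ζ * σ * (n : ℝ) ^ k := by
          field_simp
        _ = ζ * σ * (n : ℝ) ^ (k - 1 + 1) := by rw [Nat.sub_add_cancel (by omega)]
        _ = _ := by ring
    exact le_of_mul_le_mul_right (h1.trans h4) (by positivity)
  have hqζ : (q : ℝ) ≤ ζ * n := by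
    refine le_trans ?_ hAW
    have : A ∩ U ⊆ A \ W := fun v hv =>
      mem_sdiff.2 ⟨(mem_inter.1 hv).1, fun h => disjoint_left.1 hWU h (mem_inter.1 hv).2⟩
    exact_mod_cast card_le_card this
  have hW : (n : ℝ) ≤ 8 * k * W.card := by
    have h1 : A.card ≤ (A \ W).card + W.card := card_le_card_sdiff_add_card
    have h2 : (A.card : ℝ) ≤ (A \ W).card + W.card := by exact_mod_cast h1
    have h3 : (n : ℝ) ≤ 2 * k * (A.card + 1) := by exact_mod_cast hA
    have h4 : (16 * (k * k) : ℝ) ≤ n := by exact_mod_cast hkn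
    have h5 : (k : ℝ) * A.card ≤ k * (ζ * n + W.card) := by
      gcongr
      linarith
    have h6 : (k : ℝ) ≤ k * k := le_mul_of_one_le_left (by positivity) (by linarith)
    linarith
  have hUε : ∀ z ∈ U, (codeg E B {z} : ℝ) ≤ ε * (n : ℝ) ^ (k - 1) := fun z hz =>
    ((hmemU z).1 hz).trans (by gcongr)
  have hWE : ∀ a ∈ W, (((powersetCard (k - 1) B).filter fun R => insert a R ∉ E).card : ℝ) ≤
      ε * (n : ℝ) ^ (k - 1) := by
    intro a ha
    have h1 := hcod a (disjoint_left.1 hWB ha)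
    have h2 := (hmemW a).1 ha
    have h3 : ε * C ≤ ε * (n : ℝ) ^ (k - 1) := by gcongr
    linarith
  have htyp : ∀ L : Finset (Fin n), L.card = ℓ → L ⊆ U →
      (codeg E B L : ℝ) ≤ σ * (n : ℝ) ^ (k - ℓ) → IsTypical n k ℓ E B ε L := by
    intro L hLc hLU hLd
    refine ⟨hLc, hLU, ?_⟩
    rw [degIn_eq_codeg hE B L (by omega)]
    refine hLd.trans ?_
    rw [mul_assoc]
    gcongr
    exact pow_le_choose_of_le (by omega) hn4 hB
  obtain ⟨F, hF, hFd⟩ := exists_disjoint_family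
    (fun f => IsPath n k ℓ 3 E f ∧ (pathVerts n k ℓ 3 f ∩ W).card = 1 ∧
      IsTypical n k ℓ E B ε (pathEnd0 n ℓ f) ∧ IsTypical n k ℓ E B ε (pathEnd1 n k ℓ 3 f))
    (pathVerts n k ℓ 3) (4 * k) (2 * q + 2)
    (fun f => card_image_le.trans (by rw [card_range]; omega))
    (fun Z hZ => by
      obtain ⟨f, hf, hfZ, hfW, ⟨h1, h2, h3⟩, h4, h5, h6⟩ := exists_path_disjoint (Z := Z) hk hl hlk
        hq hE hdeg hBU hU hWU hB hW hσ0 hσε hη0 hη1 hηε hησ hε hεζ hζη hζ h0 hUε hWE hqζ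
        (hZ.trans (by
          calc 4 * k * (2 * q + 2) ≤ 4 * k * (4 * q) := Nat.mul_le_mul_left _ (by omega)
            _ = 16 * k * q := by ring))
      exact ⟨f, ⟨hf, hfW, htyp _ h1 h2 h3, htyp _ h4 h5 h6⟩, hfZ⟩)
  exact ⟨F, fun i => (hF i).1, hFd, fun i => (hF i).2.1, fun i => (hF i).2.2⟩
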